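/- Assume GRH. Let χ mod q be a primitive Dirichlet character with q > 1. Then for u ≥ 1 and all real t, Σ_{n ≤ u} Λ(n) χ(n) n^{-it} ≪ √u (log u) log(qu(|t|+2)). -/

import Mathlib

open Complex

/-- The Generalized Riemann Hypothesis: every zero of a Dirichlet L-function lying in the
critical strip `0 < Re(s) < 1` has real part `1/2`. -/
def GRH : Prop :=
  ∀ (N : ℕ) [NeZero N] (χ : DirichletCharacter ℂ N) (s : ℂ),
    DirichletCharacter.LFunction χ s = 0 → 0 < s.re → s.re < 1 → s.re = 1 / 2

section
open Complex
namespace GRHAux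

lemma exp_arctan_aux (y : ℝ) :
    Complex.exp (((Real.pi - 2 * Real.arctan y : ℝ) : ℂ) * I) = (I * y - 1) / (I * y + 1) := by
  have hs : (0:ℝ) < 1 + y ^ 2 := by positivity
  have hq : Real.sqrt (1 + y ^ 2) ≠ 0 := (Real.sqrt_pos.mpr hs).ne'
  have hne : (I * y + 1 : ℂ) ≠ 0 := by
    intro h; have := congrArg Complex.re h; simp at this
  have h1 : Complex.exp ((Real.arctan y : ℝ) * I) = (1 + I * y) / (Real.sqrt (1 + y ^ 2) : ℝ) := by
    rw [Complex.exp_mul_I, ← Complex.ofReal_cos, ← Complex.ofReal_sin, Real.cos_arctan, Real.sin_arctan]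
    push_cast; field_simp
  have h2 : (((Real.pi - 2 * Real.arctan y : ℝ) : ℂ) * I)
      = Real.pi * I - ((Real.arctan y : ℝ) * I + (Real.arctan y : ℝ) * I) := by push_cast; ring
  have h4 : ((Real.sqrt (1 + y ^ 2) : ℝ) : ℂ) ^ 2 = (1 + I * y) * (1 - I * y) := by
    rw [← Complex.ofReal_pow, Real.sq_sqrt hs.le]; push_cast
    linear_combination (y:ℂ)^2 * I_sq
  have hq' : ((Real.sqrt (1 + y ^ 2) : ℝ) : ℂ) ≠ 0 := by exact_mod_cast hq
  have hne' : (1 + I * y : ℂ) ≠ 0 := by rwa [add_comm]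
  rw [h2, Complex.exp_sub, Complex.exp_add, h1, Complex.exp_pi_mul_I]
  field_simp
  rw [h4]; ring

lemma cayley_re {w : ℂ} (hw : ‖w‖ < 1) : 0 ≤ ((1 + w) / (1 - w)).re := by
  have h1 : w.re ^ 2 + w.im ^ 2 < 1 := by
    have := Complex.sq_norm w
    rw [Complex.normSq_apply] at this
    nlinarith [norm_nonneg w]
  rw [Complex.div_re, ← add_div]
  apply div_nonneg _ (Complex.normSq_nonneg _)
  simp; nlinarith

theorem poisson_half_plane {g : ℂ → ℂ} {c : ℝ} (hg : DifferentiableOn ℂ g {s | c < s.re})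
    (hpos : ∀ s : ℂ, c < s.re → 0 ≤ (g s).re) {σ d : ℝ} (t : ℝ) (hσ : c < σ) (hd : 0 < d) {R : ℝ}
    (hR : 0 < R) :
    ∫ τ in (-R)..R, (g (σ + (t + τ : ℝ) * I)).re * (d / (d ^ 2 + τ ^ 2)) ≤
      Real.pi * (g (σ + d + t * I)).re := by
  have hopen : IsOpen {s : ℂ | c < s.re} := isOpen_lt continuous_const continuous_re
  let Φ : ℝ → ℝ → ℝ := fun ε τ => (g (σ + t * I + d * ((|ε| : ℝ) + I * (τ / d : ℝ)) /
    (1 + (|ε| : ℝ) * I * (τ / d : ℝ)))).re * (d / (d ^ 2 + τ ^ 2))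
  have hden : ∀ ε y : ℝ, (1 + (ε:ℂ) * I * y) ≠ 0 := by
    intro ε y h; have := congrArg Complex.re h; simp at this
  have hcont : Continuous (Function.uncurry Φ) := by
    have h1 : Continuous fun p : ℝ × ℝ => (σ + t * I + d * ((|p.1| : ℝ) + I * (p.2 / d : ℝ)) /
      (1 + (|p.1| : ℝ) * I * (p.2 / d : ℝ)) : ℂ) := by
      refine Continuous.add (by fun_prop) (Continuous.div (by fun_prop) (by fun_prop) ?_)
      intro p; exact hden _ _
    have h2 : ∀ p : ℝ × ℝ, c < (σ + t * I + d * ((|p.1| : ℝ) + I * (p.2 / d : ℝ)) /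
      (1 + (|p.1| : ℝ) * I * (p.2 / d : ℝ)) : ℂ).re := by
      intro p
      have : 0 ≤ (d * ((|p.1| : ℝ) + I * (p.2 / d : ℝ)) /
        (1 + (|p.1| : ℝ) * I * (p.2 / d : ℝ)) : ℂ).re := by
        rw [Complex.div_re, ← add_div]
        apply div_nonneg _ (Complex.normSq_nonneg _)
        simp only [mul_re, ofReal_re, add_re, I_re, zero_mul, ofReal_im, I_im, mul_zero, sub_zero,
          add_im, mul_im, one_re, one_im, zero_add, add_zero, one_mul, mul_one, sub_self, zero_sub]
        have : 0 ≤ |p.1| := abs_nonneg _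
        have e : d * (|p.1|) * 1 + d * (p.2/d) * (|p.1| * (p.2/d)) = d * |p.1| * (1 + (p.2/d)^2) := by ring
        have : 0 ≤ d * |p.1| * (1 + (p.2/d)^2) := by positivity
        simp
        nlinarith
      rw [Complex.add_re]; simp at *; linarith
    have h3 : Continuous fun p : ℝ × ℝ => g (σ + t * I + d * ((|p.1| : ℝ) + I * (p.2 / d : ℝ)) /
      (1 + (|p.1| : ℝ) * I * (p.2 / d : ℝ)) : ℂ) :=
      hg.continuousOn.comp_continuous h1 h2
    refine Continuous.mul (continuous_re.comp h3) (Continuous.div (by fun_prop) (by fun_prop) ?_)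
    intro p; positivity
  have hI : Continuous fun ε => ∫ τ in (-R)..R, Φ ε τ :=
    intervalIntegral.continuous_parametric_intervalIntegral_of_continuous' hcont _ _
  have key : ∀ ε : ℝ, 0 < ε → ε < 1 → ∫ τ in (-R)..R, Φ ε τ ≤ Real.pi * (g (σ + d + t * I)).re := by
    intro ε h0 h1
    set r : ℝ := (1 - ε) / (1 + ε) with hr
    have hr0 : 0 < r := by apply div_pos <;> linarith
    have hr1 : r < 1 := by rw [hr, div_lt_one (by linarith)]; linarith
    let G : ℂ → ℂ := fun w => g (σ + t * I + d * ((1 + w) / (1 - w)))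
    have hmem : ∀ w : ℂ, ‖w‖ < 1 → c < (σ + t * I + d * ((1 + w) / (1 - w)) : ℂ).re := by
      intro w hw
      have := cayley_re hw
      have h' : (σ + t * I + d * ((1 + w) / (1 - w)) : ℂ).re = σ + d * ((1 + w) / (1 - w)).re := by
        rw [Complex.add_re, Complex.re_ofReal_mul]; simp
      rw [h']; nlinarith [mul_nonneg hd.le this]
    have hne1 : ∀ w : ℂ, ‖w‖ < 1 → 1 - w ≠ 0 := by
      intro w hw h; rw [sub_eq_zero] at h; rw [← h] at hw; simp at hw
    have hG : DifferentiableOn ℂ G (Metric.ball 0 1) := by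
      intro w hw
      have hw : ‖w‖ < 1 := by simpa using hw
      have h2 := (hg.differentiableAt (hopen.mem_nhds (hmem w hw)))
      have h3 : DifferentiableAt ℂ (fun w : ℂ => (σ + t * I + d * ((1 + w) / (1 - w)) : ℂ)) w := by
        have := hne1 w hw
        fun_prop (disch := assumption)
      exact (DifferentiableAt.comp w h2 h3).differentiableWithinAt
    have hav : Real.circleAverage G 0 r = G 0 := by
      apply DiffContOnCl.circleAverage
      rw [abs_of_pos hr0]
      apply DifferentiableOn.diffContOnCl
      apply hG.mono
      refine (Metric.closure_ball_subset_closedBall).trans (Metric.closedBall_subset_ball hr1)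
    have hcirc : ∀ θ : ℝ, ‖circleMap 0 r θ‖ < 1 := by intro θ; simp [abs_of_pos hr0, hr1]
    let u : ℝ → ℝ := fun θ => (G (circleMap 0 r θ)).re
    have hGc : Continuous fun θ => G (circleMap 0 r θ) :=
      hG.continuousOn.comp_continuous (continuous_circleMap 0 r) (fun θ => by simpa using! hcirc θ)
    have hu : Continuous u := continuous_re.comp hGc
    have hu0 : ∀ θ, 0 ≤ u θ := fun θ => hpos _ (hmem _ (hcirc θ))
    have htot : ∫ θ in (0:ℝ)..(2 * Real.pi), u θ = 2 * Real.pi * (g (σ + d + t * I)).re := by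
      have h1 : ∫ θ in (0:ℝ)..(2 * Real.pi), G (circleMap 0 r θ) = (2 * Real.pi) • G 0 := by
        rw [← hav, Real.circleAverage, smul_smul, mul_inv_cancel₀ (by positivity), one_smul]
      have h2 := Complex.reCLM.intervalIntegral_comp_comm (hGc.intervalIntegrable 0 (2 * Real.pi))
        (μ := MeasureTheory.volume)
      have h3 : G 0 = g (σ + d + t * I) := by
        simp only [G]; congr 1; simp; ring
      simp only [Complex.reCLM_apply] at h2
      rw [h2, h1, h3]; simp
    let θ : ℝ → ℝ := fun τ => Real.pi - 2 * Real.arctan (τ / d)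
    have hθ : ∀ τ, HasDerivAt θ (-(2 * (d / (d ^ 2 + τ ^ 2)))) τ := by
      intro τ
      have h := (((hasDerivAt_id τ).div_const d).arctan.const_mul 2).const_sub Real.pi
      convert! h using 1
      simp; field_simp
    have hsub := intervalIntegral.integral_comp_mul_deriv (a := -R) (b := R) (g := u)
      (fun τ _ => hθ τ) (Continuous.continuousOn (by
        refine (Continuous.mul continuous_const (Continuous.div (by fun_prop) (by fun_prop) ?_)).neg
        intro p; positivity)) hu
    have hΦ : ∀ τ, Φ ε τ = -(1/2) * ((u ∘ θ) τ * (-(2 * (d / (d ^ 2 + τ ^ 2))))) := by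
      intro τ
      simp only [Φ, u, θ, Function.comp, G]
      have hpt : (σ + t * I + d * ((|ε| : ℝ) + I * (τ / d : ℝ)) /
        (1 + (|ε| : ℝ) * I * (τ / d : ℝ)) : ℂ) = σ + t * I + d * ((1 + circleMap 0 r (Real.pi - 2 * Real.arctan (τ / d))) /
          (1 - circleMap 0 r (Real.pi - 2 * Real.arctan (τ / d)))) := by
        have hc : circleMap 0 r (Real.pi - 2 * Real.arctan (τ / d)) =
            r * ((I * (τ / d : ℝ) - 1) / (I * (τ / d : ℝ) + 1)) := by
          rw [← exp_arctan_aux]; simp [circleMap]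
        have hd2 := hne1 _ (hcirc (Real.pi - 2 * Real.arctan (τ / d)))
        rw [hc] at hd2 ⊢
        rw [abs_of_pos h0, mul_div_assoc]
        congr 2
        generalize τ / d = y at *
        have e1 : (I * (y:ℂ) + 1) ≠ 0 := by
          have := hden 1 y; intro h; apply this; rw [← h]; simp; ring
        have e2 := hden ε y
        have e3 : ((1:ℂ) + ε) ≠ 0 := by
          have : (1:ℝ) + ε ≠ 0 := by linarith
          exact_mod_cast this
        have er : (r : ℂ) = (1 - ε) / (1 + ε) := by rw [hr]; push_cast; rfl
        rw [er] at hd2 ⊢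
        rw [div_eq_div_iff e2 hd2]
        field_simp
        ring
      rw [hpt]; ring
    have hint : ∫ τ in (-R)..R, Φ ε τ = (1/2) * ∫ x in (θ R)..(θ (-R)), u x := by
      simp_rw [hΦ]
      rw [intervalIntegral.integral_const_mul, hsub, intervalIntegral.integral_symm]
      ring
    have hle : θ R ≤ θ (-R) := by
      simp only [θ, neg_div, Real.arctan_neg]
      have : 0 ≤ Real.arctan (R / d) := by rw [Real.arctan_nonneg]; positivity
      linarith
    have ha : 0 ≤ θ R := by
      simp only [θ]; linarith [Real.arctan_lt_pi_div_two (R / d)]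
    have hb : θ (-R) ≤ 2 * Real.pi := by
      simp only [θ]; linarith [Real.neg_pi_div_two_lt_arctan (-R / d)]
    have := intervalIntegral.integral_mono_interval (μ := MeasureTheory.volume) ha hle hb
      (Filter.Eventually.of_forall hu0) (hu.intervalIntegrable _ _)
    rw [hint]; rw [htot] at this; linarith
  have h0 : ∫ τ in (-R)..R, Φ 0 τ ≤ Real.pi * (g (σ + d + t * I)).re := by
    have hlim : Filter.Tendsto (fun ε => ∫ τ in (-R)..R, Φ ε τ) (nhdsWithin 0 (Set.Ioi 0))
        (nhds (∫ τ in (-R)..R, Φ 0 τ)) := hI.continuousAt.tendsto.mono_left nhdsWithin_le_nhds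
    refine le_of_tendsto hlim ?_
    filter_upwards [Ioo_mem_nhdsGT (show (0:ℝ) < 1 by norm_num)] with ε hε
    exact key ε hε.1 hε.2
  convert h0 using 3 with τ
  simp only [Φ]
  congr 3
  have hdc : (d:ℂ) ≠ 0 := by exact_mod_cast hd.ne'
  simp; field_simp; ring

end GRHAux
end

section
open Complex MeasureTheory Filter Topology
namespace GRHAux

lemma integrable_decay : Integrable (fun x : ℝ => (1 + |x|) ^ (-(3/2) : ℝ)) := by
  have := integrable_one_add_norm (E := ℝ) (μ := volume) (r := 3/2) (by simp; norm_num)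
  simpa using this

theorem contour_shift {G : ℂ → ℂ} {a b C : ℝ} (hab : a ≤ b)
    (hG : ∀ s : ℂ, a ≤ s.re → s.re ≤ b → DifferentiableAt ℂ G s)
    (hC : ∀ s : ℂ, a ≤ s.re → s.re ≤ b → ‖G s‖ ≤ C * (1 + |s.im|) ^ (-(3/2) : ℝ)) :
    ∫ y : ℝ, G (a + y * I) = ∫ y : ℝ, G (b + y * I) := by
  have hint : ∀ x : ℝ, a ≤ x → x ≤ b → Integrable (fun y : ℝ => G (x + y * I)) := by
    intro x hx hx'
    refine Integrable.mono' (integrable_decay.const_mul C) ?_ ?_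
    · apply Continuous.aestronglyMeasurable
      rw [continuous_iff_continuousAt]; intro y
      have h1 : ContinuousAt G (x + y * I) := (hG _ (by simpa) (by simpa)).continuousAt
      exact ContinuousAt.comp (f := fun y : ℝ => (x + y * I : ℂ)) h1 (by fun_prop)
    · refine Eventually.of_forall fun y => ?_
      simpa using hC (x + y * I) (by simpa) (by simpa)
  have hrect : ∀ T : ℝ, 0 < T →
      ((∫ (x : ℝ) in a..b, G (x + (-T : ℝ) * I)) - ∫ (x : ℝ) in a..b, G (x + (T : ℝ) * I)) +
          I • (∫ (y : ℝ) in (-T)..T, G (b + y * I)) -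
        I • ∫ (y : ℝ) in (-T)..T, G (a + y * I) = 0 := by
    intro T hT
    have := integral_boundary_rect_eq_zero_of_differentiableOn G (a + (-T:ℝ) * I) (b + T * I) (by
      intro s hs
      have h1 := hs.1
      simp [Set.uIcc_of_le hab] at h1
      exact (hG s h1.1 h1.2).differentiableWithinAt)
    simpa using this
  have hhor : ∀ e : ℝ, |e| = 1 → Tendsto (fun T : ℝ => ∫ (x : ℝ) in a..b, G (x + (e * T : ℝ) * I)) atTop (𝓝 0) := by
    intro e he
    have hb : Tendsto (fun T : ℝ => C * (1 + |T|) ^ (-(3/2) : ℝ) * |b - a|) atTop (𝓝 0) := by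
      have h1 : Tendsto (fun T : ℝ => (1 + |T|) ^ (-(3/2) : ℝ)) atTop (𝓝 0) :=
        (tendsto_rpow_neg_atTop (by norm_num : (0:ℝ) < 3/2)).comp
          (tendsto_atTop_add_const_left _ _ tendsto_abs_atTop_atTop)
      simpa using (h1.const_mul C).mul_const |b - a|
    refine squeeze_zero_norm (fun T => ?_) hb
    apply intervalIntegral.norm_integral_le_of_norm_le_const
    intro x hx
    rw [Set.uIoc_of_le hab] at hx
    have := hC (x + (e * T : ℝ) * I) (by simpa using hx.1.le) (by simpa using hx.2)
    simpa [abs_mul, he] using this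
  have hlim := fun x h1 h2 => intervalIntegral_tendsto_integral (hint x h1 h2) tendsto_neg_atTop_atBot tendsto_id
  have h1 := ((hhor (-1) (by simp)).sub (hhor 1 (by simp))).add ((hlim b hab le_rfl).const_smul I)
  have h2 := h1.sub ((hlim a le_rfl hab).const_smul I)
  have h3 : Tendsto (fun T : ℝ => (0:ℂ)) atTop (𝓝 (0 - 0 + I • (∫ y : ℝ, G (b + y * I)) - I • ∫ y : ℝ, G (a + y * I))) := by
    refine h2.congr' ?_
    filter_upwards [eventually_gt_atTop 0] with T hT
    simpa using! hrect T hT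
  have h4 := tendsto_nhds_unique h3 tendsto_const_nhds
  simp only [sub_self, zero_add, smul_eq_mul, ← mul_sub] at h4
  rcases mul_eq_zero.mp h4 with h | h
  · simp at h
  · exact (sub_eq_zero.mp h).symm

/-- lower bounds on the kernel denominators -/
lemma denom_bound {c : ℝ} (hc : 0 < c) (y : ℝ) :
    min c 1 / 2 * (1 + |y|) ≤ ‖(c + y * I : ℂ)‖ := by
  have h1 : |c| ≤ ‖(c + y * I : ℂ)‖ := by simpa using Complex.abs_re_le_norm (c + y * I : ℂ)
  have h2 : |y| ≤ ‖(c + y * I : ℂ)‖ := by simpa using Complex.abs_im_le_norm (c + y * I : ℂ)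
  rw [abs_of_pos hc] at h1
  have h3 : min c 1 ≤ c := min_le_left _ _
  have h4 : min c 1 ≤ 1 := min_le_right _ _
  have h5 : 0 < min c 1 := lt_min hc one_pos
  nlinarith [abs_nonneg y]

lemma vert_integrable {c : ℝ} (hc : 0 < c) :
    Integrable (fun y : ℝ => 1 / ((c + y * I : ℂ) * (c + y * I + 1))) := by
  have hne : ∀ d : ℝ, 0 < d → ∀ y : ℝ, (d + y * I : ℂ) ≠ 0 := by
    intro d hd y h; have := congrArg Complex.re h; simp at this; linarith
  have hne1 : ∀ y : ℝ, (c + y * I + 1 : ℂ) ≠ 0 := by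
    intro y; have := hne (c + 1) (by linarith) y; rwa [show (c + y * I + 1 : ℂ) = ((c+1 : ℝ) + y * I) by push_cast; ring]
  have hm : 0 < min c 1 := lt_min hc one_pos
  refine Integrable.mono' (integrable_decay.const_mul ((min c 1 / 2)⁻¹ ^ 2)) ?_ ?_
  · apply Continuous.aestronglyMeasurable
    refine Continuous.div (by fun_prop) (by fun_prop) fun y => mul_ne_zero (hne c hc y) (hne1 y)
  · refine Eventually.of_forall fun y => ?_
    have h1 := denom_bound hc y
    have h2 : min c 1 / 2 * (1 + |y|) ≤ ‖(c + y * I + 1: ℂ)‖ := by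
      have := denom_bound (c := c + 1) (by linarith) y
      rw [show (c + y * I + 1 : ℂ) = ((c+1 : ℝ) + y * I) by push_cast; ring]
      refine le_trans ?_ this
      have : min c 1 ≤ min (c+1) 1 := min_le_min_right _ (by linarith)
      gcongr
    have h3 : 0 < 1 + |y| := by positivity
    rw [norm_div, norm_mul, norm_one]
    have h4 : ((1:ℝ) + |y|)⁻¹ ^ 2 ≤ (1 + |y|) ^ (-(3/2) : ℝ) := by
      rw [← Real.rpow_neg_one, ← Real.rpow_natCast, ← Real.rpow_mul h3.le]
      apply Real.rpow_le_rpow_of_exponent_le (by linarith [abs_nonneg y]); norm_num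
    calc 1 / (‖(c + y * I : ℂ)‖ * ‖(c + y * I + 1 : ℂ)‖)
        ≤ 1 / ((min c 1 / 2 * (1 + |y|)) * (min c 1 / 2 * (1 + |y|))) := by gcongr
      _ = (min c 1 / 2)⁻¹ ^ 2 * ((1 + |y|)⁻¹ ^ 2) := by field_simp
      _ ≤ _ := by gcongr

theorem perron {c x : ℝ} (hc : 0 < c) (hx : 0 < x) :
    ∫ y : ℝ, (x : ℂ) ^ (c + y * I : ℂ) / ((c + y * I) * (c + y * I + 1)) =
      2 * Real.pi * (max (1 - x⁻¹) 0 : ℝ) := by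
  let f : ℝ → ℂ := fun v => Set.indicator (Set.Ioc 0 1) (fun _ => (1:ℂ)) v - Set.indicator (Set.Ioc 0 1) (fun t : ℝ => (t:ℂ) ^ (1:ℂ)) v
  have hf : ∀ s : ℂ, 0 < s.re → HasMellin f s (1 / s - 1 / (s + 1)) := by
    intro s hs
    exact hasMellin_sub (hasMellin_one_Ioc hs).1 (hasMellin_cpow_Ioc 1 (by simp; linarith)).1 |>.imp id
      (fun h => by rw [h, (hasMellin_one_Ioc hs).2, (hasMellin_cpow_Ioc 1 (by simp; linarith)).2])
  have hfv : ∀ v : ℝ, 0 < v → f v = (max (1 - v) 0 : ℝ) := by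
    intro v hv
    by_cases h : v ≤ 1
    · simp [f, Set.indicator, hv, h]
    · have h' := not_le.mp h
      simp [f, Set.indicator, hv, h]
      rw [max_eq_right (by linarith)]; simp
  have hne : ∀ y : ℝ, (c + y * I : ℂ) ≠ 0 := by
    intro y h; have := congrArg Complex.re h; simp at this; linarith
  have hne1 : ∀ y : ℝ, (c + y * I + 1 : ℂ) ≠ 0 := by
    intro y h; have := congrArg Complex.re h; simp at this; linarith
  have hmel : ∀ y : ℝ, mellin f (c + y * I) = 1 / ((c + y * I) * (c + y * I + 1)) := by
    intro y
    rw [(hf (c + y * I) (by simpa)).2]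
    have := hne y; have := hne1 y
    field_simp; ring
  have hinv := mellinInv_mellin_eq c f (x := x⁻¹) (by positivity) (hf c (by simpa)).1
    (by
      unfold VerticalIntegrable
      simp_rw [hmel]; exact vert_integrable hc)
    (by
      have h1 : ContinuousAt (fun v : ℝ => ((max (1 - v) 0 : ℝ) : ℂ)) x⁻¹ := by fun_prop
      refine h1.congr ?_
      filter_upwards [lt_mem_nhds (show 0 < x⁻¹ by positivity)] with v hv
      exact (hfv v hv).symm)
  rw [hfv _ (by positivity), mellinInv] at hinv
  rw [← hinv]
  have : ∀ y : ℝ, ((x⁻¹ : ℝ) : ℂ) ^ (-(c + y * I : ℂ)) • mellin f (c + y * I) =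
     (x : ℂ) ^ (c + y * I : ℂ) / ((c + y * I) * (c + y * I + 1)) := by
    intro y
    rw [hmel, Complex.ofReal_inv, Complex.inv_cpow, Complex.cpow_neg, inv_inv]
    · simp [div_eq_mul_inv]
    · rw [Complex.arg_ofReal_of_nonneg hx.le]; exact Real.pi_pos.ne
  simp_rw [this]
  have hp : (Real.pi : ℂ) ≠ 0 := by exact_mod_cast Real.pi_ne_zero
  simp only [Complex.real_smul]
  push_cast
  rw [← mul_assoc, mul_one_div_cancel (by simpa using hp), one_mul]

end GRHAux
end

section
open Complex MeasureTheory Filter Topology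
namespace GRHAux
open DirichletCharacter

lemma sum_bound {q : ℕ} [NeZero q] {χ : DirichletCharacter ℂ q} (hχ : χ ≠ 1) (n : ℕ) :
    ‖∑ k ∈ Finset.Icc 1 n, χ (k : ZMod q)‖ ≤ q := by
  have hper : ∑ k ∈ Finset.range q, χ ((k + 1 : ℕ) : ZMod q) = 0 := by
    have h1 : ∑ k ∈ Finset.range q, χ ((k + 1 : ℕ) : ZMod q) = ∑ a : ZMod q, χ (a + 1) := by
      refine Finset.sum_bij' (fun k _ => (k : ZMod q)) (fun a _ => a.val) ?_ ?_ ?_ ?_ ?_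
      · simp
      · intro a _; simpa using ZMod.val_lt a
      · intro k hk; exact ZMod.val_cast_of_lt (by simpa using hk)
      · intro a _; simp
      · intro k _; push_cast; rfl
    rw [h1, ← MulChar.sum_eq_zero_of_ne_one hχ]
    exact Equiv.sum_comp (Equiv.addRight (1 : ZMod q)) (fun a => χ a)
  have hrange : ∀ n : ℕ, ‖∑ k ∈ Finset.range n, χ ((k + 1 : ℕ) : ZMod q)‖ ≤ q := by
    intro n
    induction n using Nat.strong_induction_on with
    | _ n ih =>
      by_cases hn : n < q
      · refine (norm_sum_le _ _).trans ?_
        calc _ ≤ ∑ k ∈ Finset.range n, (1:ℝ) := Finset.sum_le_sum fun k _ => χ.norm_le_one _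
          _ = n := by simp
          _ ≤ q := by exact_mod_cast hn.le
      · have hq : 0 < q := Nat.pos_of_ne_zero (NeZero.ne q)
        obtain ⟨m, rfl⟩ := Nat.exists_eq_add_of_le (not_lt.mp hn)
        rw [Finset.sum_range_add, hper, zero_add]
        have := ih m (by omega)
        convert this using 4 with k hk
        push_cast; simp
  have : ∑ k ∈ Finset.Icc 1 n, χ (k : ZMod q) = ∑ k ∈ Finset.range n, χ ((k + 1 : ℕ) : ZMod q) := by
    rw [Finset.range_eq_Ico, Finset.sum_Ico_add' (fun k : ℕ => χ (k : ZMod q)) 0 n 1]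
    rfl
  rw [this]; exact hrange n

theorem LFunction_bound {q : ℕ} [NeZero q] {χ : DirichletCharacter ℂ q} (hχ : χ ≠ 1) {s : ℂ}
    (hs : 0 < s.re) : ‖LFunction χ s‖ ≤ q * ‖s‖ / s.re := by
  let S : ℝ → ℂ := fun t => ∑ k ∈ Finset.Icc 1 ⌊t⌋₊, χ (k : ZMod q)
  have hSb : ∀ t, ‖S t‖ ≤ q := fun t => sum_bound hχ _
  have hS0 : ∀ t, t < 1 → S t = 0 := by
    intro t ht
    simp [S, Nat.floor_eq_zero.mpr ht]
  have hSm : Measurable S := by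
    have : S = (fun n : ℕ => ∑ k ∈ Finset.Icc 1 n, χ (k : ZMod q)) ∘ (fun t : ℝ => ⌊t⌋₊) := rfl
    rw [this]
    exact (measurable_from_nat).comp Nat.measurable_floor
  let g : ℂ → ℂ := fun s => s * mellin S (-s)
  have hSint : LocallyIntegrableOn S (Set.Ioi 0) := by
    apply LocallyIntegrable.locallyIntegrableOn
    have hc : LocallyIntegrable (fun _ : ℝ => (q:ℝ)) := locallyIntegrable_const _
    exact hc.mono hSm.aestronglyMeasurable (Eventually.of_forall fun t => by simpa using hSb t)
  have hdiff : ∀ s : ℂ, 0 < s.re → DifferentiableAt ℂ g s := by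
    intro s hs
    have h1 : DifferentiableAt ℂ (mellin S) (-s) := by
      refine mellin_differentiableAt_of_isBigO_rpow (a := 0) (b := -s.re - 1) hSint ?_ (by simpa) ?_ (by simp)
      · refine Asymptotics.IsBigO.of_bound q (Eventually.of_forall fun t => ?_)
        simpa using hSb t
      · refine Asymptotics.IsBigO.of_bound 1 ?_
        filter_upwards [Ioo_mem_nhdsGT (show (0:ℝ) < 1 by norm_num)] with t ht
        rw [hS0 t ht.2]; simp
    have h2 : DifferentiableAt ℂ (fun s => mellin S (-s)) s :=
      DifferentiableAt.comp (g := mellin S) (f := fun s : ℂ => -s) s h1 (differentiableAt_id.neg)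
    exact differentiableAt_id.mul h2
  have hrep : ∀ s : ℂ, mellin S (-s) = ∫ t in Set.Ioi (1:ℝ), S t * (t:ℂ) ^ (-(s + 1)) := by
    intro s
    rw [mellin, ← integral_indicator measurableSet_Ioi, ← integral_indicator measurableSet_Ioi]
    apply integral_congr_ae
    have : ∀ᵐ t : ℝ, t ≠ 1 := by simp [ae_iff]
    filter_upwards [this] with t ht
    by_cases h1 : 1 < t
    · rw [Set.indicator_of_mem (show t ∈ Set.Ioi (0:ℝ) by simp; linarith), Set.indicator_of_mem (show t ∈ Set.Ioi (1:ℝ) from h1)]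
      rw [smul_eq_mul, mul_comm]; congr 2; ring
    · have h2 : t < 1 := lt_of_le_of_ne (not_lt.mp h1) ht
      rw [Set.indicator_of_notMem (show t ∉ Set.Ioi (1:ℝ) from h1)]
      by_cases h0 : 0 < t
      · rw [Set.indicator_of_mem (show t ∈ Set.Ioi (0:ℝ) from h0), hS0 t h2]; simp
      · rw [Set.indicator_of_notMem (show t ∉ Set.Ioi (0:ℝ) from h0)]
  have heq : Set.EqOn (LFunction χ) g {s | 0 < s.re} := by
    have hop : IsOpen {s : ℂ | 0 < s.re} := isOpen_lt continuous_const continuous_re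
    have hA1 : AnalyticOnNhd ℂ (LFunction χ) {s | 0 < s.re} :=
      ((differentiable_LFunction hχ).differentiableOn).analyticOnNhd hop
    have hA2 : AnalyticOnNhd ℂ g {s | 0 < s.re} :=
      (show DifferentiableOn ℂ g {s | 0 < s.re} from fun s hs => (hdiff s hs).differentiableWithinAt).analyticOnNhd hop
    refine hA1.eqOn_of_preconnected_of_eventuallyEq hA2 (convex_halfSpace_re_gt 0).isPreconnected
      (z₀ := 2) (by simp) ?_
    have : {s : ℂ | 1 < s.re} ∈ 𝓝 (2:ℂ) := (isOpen_lt continuous_const continuous_re).mem_nhds (by simp)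
    filter_upwards [this] with s hs
    rw [LFunction_eq_LSeries χ hs]
    rw [LSeries_eq_mul_integral _ le_rfl (lt_trans one_pos hs) (LSeriesSummable_of_one_lt_re χ hs)]
    · simp only [g]; rw [hrep]
    · refine Asymptotics.IsBigO.of_bound q (Eventually.of_forall fun n => ?_)
      simpa using sum_bound hχ n
  rw [heq hs]
  simp only [g]
  rw [hrep, norm_mul]
  have h1 : ‖∫ t in Set.Ioi (1:ℝ), S t * (t:ℂ) ^ (-(s + 1))‖ ≤ ∫ t in Set.Ioi (1:ℝ), q * t ^ (-s.re - 1) := by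
    refine norm_integral_le_of_norm_le ?_ ?_
    · exact (integrableOn_Ioi_rpow_of_lt (by linarith) one_pos).const_mul _
    · refine (ae_restrict_iff' measurableSet_Ioi).mpr (Eventually.of_forall fun t ht => ?_)
      have ht : 1 < t := ht
      rw [norm_mul, Complex.norm_cpow_eq_rpow_re_of_pos (by linarith)]
      have : (-(s + 1)).re = -s.re - 1 := by simp; ring
      rw [this]
      gcongr
      exact hSb t
  rw [integral_const_mul, integral_Ioi_rpow_of_lt (by linarith) one_pos] at h1
  calc _ ≤ ‖s‖ * (q * (-1 ^ (-s.re - 1 + 1) / (-s.re - 1 + 1))) := by gcongr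
    _ = _ := by
      rw [Real.one_rpow, show -s.re - 1 + 1 = -s.re by ring, neg_div_neg_eq]; ring
end GRHAux
end

section
open Complex MeasureTheory Filter Topology
namespace GRHAux
open DirichletCharacter

theorem growth_general {L : ℂ → ℂ} {b K m a : ℝ} (hL : ∀ s : ℂ, b < s.re → DifferentiableAt ℂ L s)
    (hne : ∀ s : ℂ, b < s.re → L s ≠ 0) (hb : 0 ≤ b) (hK : 0 < K)
    (hLK : ∀ s : ℂ, b < s.re → ‖L s‖ ≤ K * (1 + ‖s‖)) (hm : 0 < m)
    (hLm : ∀ s : ℂ, 2 ≤ s.re → m ≤ ‖L s‖) (ha : 0 < a) (ha1 : a ≤ 1) :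
    ∃ C > 0, ∀ s : ℂ, b + a ≤ s.re → ‖logDeriv L s‖ ≤ C * √(1 + ‖s‖) ∧
      Real.exp (-(C * √(1 + ‖s‖))) ≤ ‖L s‖ := by
  set C1 := 2 * √(6 * (K / m)) with hC1
  have hC1p : 0 < C1 := by positivity
  set C2 := 24 / a * C1 with hC2
  have hC2p : 0 < C2 := by positivity
  refine ⟨C2 / (a/4) + C2 + |Real.log m|, by positivity, fun s hs => ?_⟩
  set w := √(1 + ‖s‖) with hw
  have hw1 : 1 ≤ w := by rw [hw, Real.one_le_sqrt]; linarith [norm_nonneg s]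
  have hopen : IsOpen {s : ℂ | b < s.re} := isOpen_lt continuous_const continuous_re
  set c := s + 2 with hc
  set R := 2 + a / 2 with hR
  have hball : ∀ z ∈ Metric.ball c R, b < z.re ∧ ‖z‖ ≤ ‖s‖ + 5 := by
    intro z hz
    have h0 : ‖z - c‖ < R := by simpa [dist_eq_norm] using hz
    have h1 := (abs_le.mp (abs_re_le_norm (z - c))).1
    have h2 : (z - c).re = z.re - s.re - 2 := by simp [hc]; ring
    constructor
    · rw [h2] at h1; linarith
    · have : ‖z‖ ≤ ‖z - c‖ + ‖s‖ + ‖(2:ℂ)‖ := by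
        calc ‖z‖ = ‖(z - c) + s + 2‖ := by congr 1; rw [hc]; ring
          _ ≤ _ := norm_add₃_le
      simp at this; linarith
  have hcR : c ∈ Metric.ball c R := Metric.mem_ball_self (by positivity)
  have hLd : DifferentiableOn ℂ L {s | b < s.re} := fun z hz => (hL z hz).differentiableWithinAt
  have hld : DifferentiableOn ℂ (logDeriv L) (Metric.ball c R) := by
    intro z hz
    have hz' := (hball z hz).1
    have : DifferentiableAt ℂ (deriv L) z :=
      (hLd.deriv hopen).differentiableAt (hopen.mem_nhds hz')
    exact (this.div (hL z hz') (hne z hz')).differentiableWithinAt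
  obtain ⟨g, hg0, hg⟩ := hld.isExactOn_ball.with_val_at c 0
  -- L = L c * exp g
  have hexp : ∀ z ∈ Metric.ball c R, L z = L c * Complex.exp (g z) := by
    have hder : ∀ z ∈ Metric.ball c R, HasDerivAt (fun z => L z * Complex.exp (-g z)) 0 z := by
      intro z hz
      have hz' := (hball z hz).1
      have h1 := (hL z hz').hasDerivAt.mul ((hg z hz).neg.cexp)
      refine h1.congr_deriv ?_
      rw [logDeriv_apply]
      have := hne z hz'
      field_simp
      simp
    intro z hz
    have := (convex_ball c R).is_const_of_fderivWithin_eq_zero (𝕜 := ℂ)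
      (f := fun z => L z * Complex.exp (-g z))
      (fun z hz => (hder z hz).differentiableAt.differentiableWithinAt) (fun z hz => by
        rw [fderivWithin_of_isOpen Metric.isOpen_ball hz]
        rw [(hder z hz).hasFDerivAt.fderiv]; ext; simp) hz hcR
    simp only [hg0, neg_zero, Complex.exp_zero, mul_one] at this
    rw [← this, mul_assoc, ← Complex.exp_add]; simp
  have hcm : m ≤ ‖L c‖ := by
    apply hLm; simp [hc]; linarith
  have hre : ∀ z ∈ Metric.ball c R, (g z).re ≤ C1 * w := by
    intro z hz
    have h1 := hexp z hz
    have h2 : ‖L z‖ = ‖L c‖ * Real.exp (g z).re := by rw [h1, norm_mul, Complex.norm_exp]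
    have h3 := hLK z (hball z hz).1
    have h4 : m * Real.exp (g z).re ≤ K * (6 * (1 + ‖s‖)) := by
      calc _ ≤ ‖L c‖ * Real.exp (g z).re := by gcongr
        _ = ‖L z‖ := h2.symm
        _ ≤ K * (1 + ‖z‖) := h3
        _ ≤ _ := by
          have := (hball z hz).2
          gcongr; linarith [norm_nonneg s]
    have h5 : Real.exp (g z).re ≤ 6 * (K / m) * (1 + ‖s‖) := by
      rw [show 6 * (K / m) * (1 + ‖s‖) = K * (6 * (1 + ‖s‖)) / m by ring, le_div_iff₀ hm]; linarith
    have hpos : 0 < 6 * (K / m) * (1 + ‖s‖) := by positivity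
    have h6 : (g z).re ≤ Real.log (6 * (K / m) * (1 + ‖s‖)) := by
      rw [Real.le_log_iff_exp_le hpos]; exact h5
    have h7 : Real.log (6 * (K / m) * (1 + ‖s‖)) ≤ 2 * √(6 * (K / m) * (1 + ‖s‖)) := by
      have h8 := Real.log_le_self (Real.sqrt_nonneg (6 * (K / m) * (1 + ‖s‖)))
      rw [Real.log_sqrt hpos.le] at h8
      linarith
    rw [Real.sqrt_mul (by positivity)] at h7
    calc _ ≤ _ := h6
      _ ≤ _ := h7
      _ = _ := by rw [hC1]; ring
  have hgb : ∀ z, ‖z - s‖ ≤ a / 4 → ‖g z‖ ≤ C2 * w := by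
    intro z hz
    have hn : ‖z - c‖ ≤ 2 + a / 4 := by
      calc ‖z - c‖ = ‖(z - s) - 2‖ := by congr 1; rw [hc]; ring
        _ ≤ ‖z - s‖ + ‖(2:ℂ)‖ := norm_sub_le _ _
        _ ≤ _ := by simp; linarith
    have hzb : z ∈ Metric.ball c R := by
      rw [Metric.mem_ball, dist_eq_norm]; linarith
    have hmap : ∀ y ∈ Metric.ball (0:ℂ) R, y + c ∈ Metric.ball c R := by
      intro y hy; simpa [dist_eq_norm] using hy
    have := borelCaratheodory_zero (f := fun y => g (y + c)) (M := C1 * w) (R := R) (z := z - c)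
      (by positivity) (fun y hy => by
        have h1 := (hg _ (hmap y hy)).differentiableAt
        exact (h1.comp y (by fun_prop : DifferentiableAt ℂ (fun y => y + c) y)).differentiableWithinAt)
      (fun y hy => hre _ (hmap y hy)) (by positivity) (by simpa [dist_eq_norm] using hzb) (by simpa using hg0)
    simp only [sub_add_cancel] at this
    calc _ ≤ _ := this
      _ ≤ 2 * (C1 * w) * 3 / (a / 4) := by
        gcongr
        · linarith
        · rw [hR]; linarith
      _ = _ := by rw [hC2]; ring
  have hsb : s ∈ Metric.ball c R := by
    rw [Metric.mem_ball, dist_eq_norm, hc]; simp; linarith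
  have hsub : ∀ z ∈ Metric.closedBall s (a/4), z ∈ Metric.ball c R := by
    intro z hz
    have hz : ‖z - s‖ ≤ a/4 := by simpa [dist_eq_norm] using hz
    have : ‖z - c‖ ≤ 2 + a / 4 := by
      calc ‖z - c‖ = ‖(z - s) - 2‖ := by congr 1; rw [hc]; ring
        _ ≤ ‖z - s‖ + ‖(2:ℂ)‖ := norm_sub_le _ _
        _ ≤ _ := by simp; linarith
    rw [Metric.mem_ball, dist_eq_norm]; linarith
  constructor
  · have h1 : ‖deriv g s‖ ≤ C2 * w / (a/4) := by
      refine norm_deriv_le_of_forall_mem_sphere_norm_le (by positivity) ?_ ?_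
      · refine DifferentiableOn.diffContOnCl_ball (U := Metric.ball c R) ?_ hsub
        exact fun z hz => (hg z hz).differentiableAt.differentiableWithinAt
      · intro z hz; exact hgb z (by simpa [dist_eq_norm] using (Metric.sphere_subset_closedBall hz))
    rw [(hg s hsb).deriv] at h1
    calc _ ≤ _ := h1
      _ = C2 / (a/4) * w := by ring
      _ ≤ _ := by gcongr; linarith [abs_nonneg (Real.log m)]
  · have h1 := hexp s hsb
    have h2 : ‖L s‖ = ‖L c‖ * Real.exp (g s).re := by rw [h1, norm_mul, Complex.norm_exp]
    have h3 := hgb s (by simp; positivity)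
    have h4 := (abs_le.mp (abs_re_le_norm (g s))).1
    rw [h2]
    calc _ ≤ Real.exp (Real.log m + (g s).re) := by
          apply Real.exp_le_exp.mpr
          have h5 := neg_abs_le (Real.log m)
          have h6 : |Real.log m| ≤ |Real.log m| * w := le_mul_of_one_le_right (abs_nonneg _) hw1
          have h7 : 0 ≤ C2 / (a/4) * w := by positivity
          nlinarith
      _ = m * Real.exp (g s).re := by rw [Real.exp_add, Real.exp_log hm]
      _ ≤ _ := by gcongr

lemma L_lower {q : ℕ} [NeZero q] (χ : DirichletCharacter ℂ q) {s : ℂ} (hs : 2 ≤ s.re) :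
    1/5 ≤ ‖LFunction χ s‖ := by
  have hs1 : 1 < s.re := by linarith
  rw [LFunction_eq_LSeries χ hs1, LSeries]
  have hsum : Summable (LSeries.term (fun n => χ (n : ZMod q)) s) := LSeriesSummable_of_one_lt_re χ hs1
  rw [← hsum.sum_add_tsum_nat_add 2]
  have hz := hasSum_zeta_two
  have hz2 := hz.summable.sum_add_tsum_nat_add 2
  rw [hz.tsum_eq] at hz2
  simp [Finset.sum_range_succ] at hz2
  have h1 : ‖∑' i, LSeries.term (fun n => χ (n : ZMod q)) s (i + 2)‖ ≤ ∑' i : ℕ, (((i:ℝ) + 2)^2)⁻¹ := by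
    refine tsum_of_norm_bounded (f := fun i : ℕ => LSeries.term (fun n => χ (n : ZMod q)) s (i + 2)) (Summable.hasSum ?_) fun i => ?_
    · have := (summable_nat_add_iff 2).mpr hz.summable
      simpa using this
    · rw [LSeries.norm_term_eq, if_neg (by omega)]
      calc _ ≤ 1 / ((i + 2 : ℕ):ℝ) ^ (2:ℝ) := by
            gcongr
            · exact χ.norm_le_one _
            · push_cast; linarith
        _ = _ := by rw [one_div]; norm_cast
  have h2 : ∑ i ∈ Finset.range 2, LSeries.term (fun n => χ (n : ZMod q)) s i = 1 := by
    simp [Finset.sum_range_succ, LSeries.term_def]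
  rw [h2]
  have h3 : ‖(1:ℂ)‖ - ‖∑' i, LSeries.term (fun n => χ (n : ZMod q)) s (i + 2)‖ ≤
    ‖1 + ∑' i, LSeries.term (fun n => χ (n : ZMod q)) s (i + 2)‖ := by
    have := norm_sub_norm_le (1:ℂ) (-∑' i, LSeries.term (fun n => χ (n : ZMod q)) s (i + 2))
    simpa using this
  rw [norm_one] at h3
  have hpi := Real.pi_lt_d2
  have hpi0 := Real.pi_pos
  have : ∑' i : ℕ, (((i:ℝ) + 2)^2)⁻¹ = Real.pi^2/6 - 1 := by linarith
  rw [this] at h1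
  nlinarith

lemma L_ne_zero (hG : GRH) {q : ℕ} [NeZero q] {χ : DirichletCharacter ℂ q} (hχ : χ ≠ 1) {s : ℂ}
    (hs : 1/2 < s.re) : LFunction χ s ≠ 0 := by
  intro h
  by_cases h1 : 1 ≤ s.re
  · exact LFunction_ne_zero_of_one_le_re χ (Or.inl hχ) h1 h
  · have := hG q χ s h (by linarith) (by linarith)
    linarith

theorem growth (hG : GRH) {q : ℕ} [NeZero q] {χ : DirichletCharacter ℂ q} (hχ : χ ≠ 1) {a : ℝ}
    (ha : 0 < a) (ha1 : a ≤ 1) :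
    ∃ C > 0, ∀ s : ℂ, 1/2 + a ≤ s.re → ‖logDeriv (LFunction χ) s‖ ≤ C * √(1 + ‖s‖) ∧
      Real.exp (-(C * √(1 + ‖s‖))) ≤ ‖LFunction χ s‖ := by
  have hq : (0:ℝ) < q := by exact_mod_cast Nat.pos_of_ne_zero (NeZero.ne q)
  refine growth_general (K := 2 * q) (m := 1/5) (fun s _ => differentiable_LFunction hχ s)
    (fun s hs => L_ne_zero hG hχ hs) (by norm_num) (by positivity) ?_ (by norm_num)
    (fun s hs => L_lower χ hs) ha ha1
  intro s hs
  refine (LFunction_bound hχ (by linarith)).trans ?_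
  rw [div_le_iff₀ (by linarith)]
  have := norm_nonneg s
  have h1 : 2 * q * (1 + ‖s‖) * (1/2) ≤ 2 * q * (1 + ‖s‖) * s.re := by gcongr
  nlinarith
end GRHAux
end

section
open Complex MeasureTheory Filter Topology
namespace GRHAux
open DirichletCharacter

lemma hasDerivAt_log_norm {f : ℂ → ℂ} {z : ℂ} {a : ℝ} (hf : DifferentiableAt ℂ f (z + a))
    (hne : f (z + a) ≠ 0) :
    HasDerivAt (fun x : ℝ => Real.log ‖f (z + x)‖) (logDeriv f (z + a)).re a := by
  have h1 : HasDerivAt (fun w : ℂ => f (z + w)) (deriv f (z + a)) (a:ℂ) := by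
    have := hf.hasDerivAt
    exact HasDerivAt.comp_const_add z (a:ℂ) this
  have h2 : HasDerivAt (fun x : ℝ => f (z + x)) (deriv f (z + a)) a := h1.comp_ofReal
  have h3 := h2.norm_sq
  have hn : ‖f (z + a)‖ ^ 2 ≠ 0 := by simpa using hne
  have h4 := (h3.log hn).div_const 2
  have h5 : (fun x : ℝ => Real.log ‖f (z + x)‖) = fun x : ℝ => Real.log (‖f (z + x)‖ ^ 2) / 2 := by
    ext x; rw [Real.log_pow]; push_cast; ring
  rw [h5]
  refine h4.congr_deriv ?_
  rw [logDeriv_apply, Complex.inner, Complex.div_re]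
  rw [← Complex.normSq_eq_norm_sq]
  have : normSq (f (z + a)) ≠ 0 := by simpa using hne
  field_simp
  simp [Complex.mul_re]

lemma gamma_ratio1 {z : ℂ} {a : ℝ} (hz : 0 < z.re) (ha : 0 < a) :
    ‖Gamma z‖ * Real.Gamma (z.re + a) ≤ ‖Gamma (z + a)‖ * Real.Gamma z.re := by
  have h1 := Complex.Gamma_mul_Gamma_eq_betaIntegral hz (t := (a:ℂ)) (by simpa using ha)
  have h2 := Complex.Gamma_mul_Gamma_eq_betaIntegral (s := (z.re:ℂ)) (by simpa using hz) (t := (a:ℂ)) (by simpa using ha)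
  set b : ℝ := ∫ x in (0:ℝ)..1, x ^ (z.re - 1) * (1 - x) ^ (a - 1) with hb
  have h3 : Complex.betaIntegral (z.re:ℂ) a = (b : ℂ) := by
    rw [hb, ← intervalIntegral.integral_ofReal, Complex.betaIntegral]
    refine intervalIntegral.integral_congr fun x hx => ?_
    rw [Set.uIcc_of_le zero_le_one] at hx
    push_cast
    rw [Complex.ofReal_cpow hx.1, Complex.ofReal_cpow (by linarith [hx.2])]
    push_cast; rfl
  have h4 : ‖Complex.betaIntegral z a‖ ≤ b := by
    rw [hb, Complex.betaIntegral]
    refine (intervalIntegral.norm_integral_le_integral_norm zero_le_one).trans (le_of_eq ?_)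
    refine intervalIntegral.integral_congr_ae ?_
    have e1 : ∀ᵐ x : ℝ, x ≠ 1 := by simp [ae_iff]
    filter_upwards [e1] with x hx1 hx
    rw [Set.uIoc_of_le zero_le_one] at hx
    have hlt : x < 1 := lt_of_le_of_ne hx.2 hx1
    rw [norm_mul, Complex.norm_cpow_eq_rpow_re_of_pos hx.1]
    have : (1 - (x:ℂ)) = ((1 - x : ℝ) : ℂ) := by push_cast; rfl
    rw [this, Complex.norm_cpow_eq_rpow_re_of_pos (by linarith)]
    simp
  rw [h3, Complex.Gamma_ofReal, Complex.Gamma_ofReal] at h2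
  have h2' : Real.Gamma z.re * Real.Gamma a = Real.Gamma (z.re + a) * b := by
    rw [← Complex.ofReal_add, Complex.Gamma_ofReal] at h2
    exact_mod_cast h2
  have h1' := congrArg norm h1
  rw [norm_mul, norm_mul, Complex.Gamma_ofReal, Complex.norm_real, Real.norm_of_nonneg (Real.Gamma_pos_of_pos ha).le] at h1'
  have hga := Real.Gamma_pos_of_pos ha
  have hgp := Real.Gamma_pos_of_pos (show 0 < z.re + a by linarith)
  have : (‖Gamma z‖ * Real.Gamma (z.re + a)) * Real.Gamma a ≤ (‖Gamma (z + a)‖ * Real.Gamma z.re) * Real.Gamma a := by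
    calc _ = (‖Gamma z‖ * Real.Gamma a) * Real.Gamma (z.re + a) := by ring
      _ = ‖Gamma (z + a)‖ * ‖Complex.betaIntegral z a‖ * Real.Gamma (z.re + a) := by rw [h1']
      _ ≤ ‖Gamma (z + a)‖ * b * Real.Gamma (z.re + a) := by gcongr
      _ = ‖Gamma (z + a)‖ * (Real.Gamma (z.re + a) * b) := by ring
      _ = _ := by rw [← h2']; ring
  exact le_of_mul_le_mul_right this hga

lemma gamma_ratio {z : ℂ} {a : ℝ} (hz : 0 < z.re) (ha : 0 < a) (ha1 : a < 1) :
    ‖Gamma z‖ * z.re ≤ ‖Gamma (z + a)‖ * (z.re + a) ^ (1 - a) := by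
  have h1 := gamma_ratio1 hz ha
  set x := z.re
  have hgp := Real.Gamma_pos_of_pos (show 0 < x + a by linarith)
  have hgx := Real.Gamma_pos_of_pos hz
  have h2 := Real.Gamma_mul_add_mul_le_rpow_Gamma_mul_rpow_Gamma (s := x + a) (t := x + a + 1) (a := a) (b := 1 - a)
    (by linarith) (by linarith) ha (by linarith) (by ring)
  rw [show a * (x + a) + (1 - a) * (x + a + 1) = x + 1 by ring, Real.Gamma_add_one hz.ne',
    Real.Gamma_add_one (by linarith), Real.mul_rpow (by linarith) hgp.le] at h2
  have h3 : Real.Gamma (x + a) ^ a * ((x + a) ^ (1 - a) * Real.Gamma (x + a) ^ (1 - a)) =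
      (x + a) ^ (1 - a) * Real.Gamma (x + a) := by
    rw [mul_left_comm, ← Real.rpow_add hgp]; simp
  rw [h3] at h2
  have : (‖Gamma z‖ * x) * Real.Gamma (x + a) ≤ (‖Gamma (z + a)‖ * (x + a) ^ (1 - a)) * Real.Gamma (x + a) := by
    calc _ = (‖Gamma z‖ * Real.Gamma (x + a)) * x := by ring
      _ ≤ (‖Gamma (z + a)‖ * Real.Gamma x) * x := by gcongr
      _ = ‖Gamma (z + a)‖ * (x * Real.Gamma x) := by ring
      _ ≤ ‖Gamma (z + a)‖ * ((x + a) ^ (1 - a) * Real.Gamma (x + a)) := by gcongr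
      _ = _ := by ring
  exact le_of_mul_le_mul_right this hgp

lemma gamma_diff {z : ℂ} (hz : 0 < z.re) : DifferentiableAt ℂ Gamma z := by
  apply Complex.differentiableAt_Gamma
  intro m h
  rw [h] at hz
  simp at hz
  linarith [Nat.cast_nonneg (α := ℝ) m]

lemma deriv_nonneg_of_right {f : ℝ → ℝ} {f' : ℝ} {e : ℝ} (he : 0 < e) (hf : HasDerivAt f f' 0) (h0 : f 0 = 0)
    (h : ∀ a, 0 < a → a < e → 0 ≤ f a) : 0 ≤ f' := by
  have h1 := hf.hasDerivWithinAt (s := Set.Ioi 0)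
  rw [hasDerivWithinAt_iff_tendsto_slope' (by simp)] at h1
  refine ge_of_tendsto h1 ?_
  filter_upwards [Ioo_mem_nhdsGT he] with a ha
  rw [slope_def_field, h0]
  have := h a ha.1 ha.2
  simp only [sub_zero]
  exact div_nonneg this ha.1.le

lemma digamma_lower {z : ℂ} (hz : 1/4 ≤ z.re) : -6 ≤ (logDeriv Gamma z).re := by
  have hz0 : 0 < z.re := by linarith
  have h1 : HasDerivAt (fun x : ℝ => Real.log ‖Gamma (z + x)‖) (logDeriv Gamma (z + (0:ℝ))).re 0 :=
    hasDerivAt_log_norm (gamma_diff (by simpa using hz0)) (Gamma_ne_zero_of_re_pos (by simpa using hz0))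
  simp only [ofReal_zero, add_zero] at h1
  have h2 : HasDerivAt (fun x : ℝ => (1 - x) * Real.log (z.re + x)) (-1 * Real.log (z.re + 0) + (1 - 0) * (1 / (z.re + 0))) 0 := by
    have := ((hasDerivAt_id (0:ℝ)).const_sub 1).mul (((hasDerivAt_id (0:ℝ)).const_add z.re).log (by simpa using hz0.ne'))
    exact this
  have h3 := ((h1.sub_const (Real.log ‖Gamma z‖)).add h2).sub_const (Real.log z.re)
  have h4 := deriv_nonneg_of_right one_pos h3 (by simp) ?_
  · simp at h4
    have h5 : z.re⁻¹ ≤ 4 := by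
      rw [inv_le_comm₀ hz0 (by norm_num)]; linarith
    have h6 : -Real.log z.re ≤ 2 := by
      rw [← Real.log_inv]
      calc _ ≤ Real.log 4 := Real.log_le_log (by positivity) h5
        _ = 2 * Real.log 2 := by rw [show (4:ℝ) = 2^2 by norm_num, Real.log_pow]; norm_num
        _ ≤ 2 := by linarith [Real.log_two_lt_d9]
    linarith
  · intro a ha ha1
    have := gamma_ratio hz0 ha ha1
    have e1 : 0 < ‖Gamma z‖ := by simpa using (Gamma_ne_zero_of_re_pos hz0)
    have e2 : 0 < ‖Gamma (z + a)‖ := by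
      have : Gamma (z + a) ≠ 0 := Gamma_ne_zero_of_re_pos (by simp; linarith)
      simpa using this
    have e3 : 0 < z.re + a := by linarith
    have h5 := Real.log_le_log (by positivity) this
    rw [Real.log_mul e1.ne' hz0.ne', Real.log_mul e2.ne' (by positivity), Real.log_rpow e3] at h5
    simp only [Pi.add_apply]
    linarith

lemma digamma_mvt {z : ℂ} (hz : 0 < z.re) :
    ∃ θ ∈ Set.Ioo (0:ℝ) 1, (logDeriv Gamma (z + θ)).re = Real.log ‖z‖ := by
  have hd : ∀ x : ℝ, 0 ≤ x → HasDerivAt (fun x : ℝ => Real.log ‖Gamma (z + x)‖) (logDeriv Gamma (z + x)).re x := by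
    intro x hx
    have : 0 < (z + x).re := by simp; linarith
    exact hasDerivAt_log_norm (gamma_diff this) (Gamma_ne_zero_of_re_pos this)
  obtain ⟨θ, hθ, h⟩ := exists_hasDerivAt_eq_slope (fun x : ℝ => Real.log ‖Gamma (z + x)‖)
    (fun x : ℝ => (logDeriv Gamma (z + x)).re) (zero_lt_one) (fun x hx => (hd x hx.1).continuousAt.continuousWithinAt)
    (fun x hx => hd x hx.1.le)
  refine ⟨θ, hθ, ?_⟩
  have hz' : z ≠ 0 := by rintro rfl; simp at hz
  have e1 : Gamma z ≠ 0 := (Gamma_ne_zero_of_re_pos hz)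
  rw [h]
  simp only [ofReal_one, ofReal_zero, add_zero, sub_zero, div_one]
  rw [Complex.Gamma_add_one z hz', norm_mul, Real.log_mul (by simpa) (by simpa)]
  ring
end GRHAux
end

section
open Complex MeasureTheory Filter Topology
namespace GRHAux
open DirichletCharacter ComplexConjugate

lemma LFunction_conj {q : ℕ} [NeZero q] {χ : DirichletCharacter ℂ q} (hχ : χ ≠ 1) (s : ℂ) :
    LFunction χ⁻¹ (conj s) = conj (LFunction χ s) := by
  have hχ' : χ⁻¹ ≠ 1 := by simpa using hχ
  have h1 : Differentiable ℂ (fun s => conj (LFunction χ⁻¹ (conj s))) := by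
    intro s
    have := (differentiable_LFunction hχ' (conj s)).conj_conj
    simpa [Function.comp_def] using this
  have h2 : (fun s => conj (LFunction χ⁻¹ (conj s))) = LFunction χ := by
    refine AnalyticOnNhd.eq_of_eventuallyEq (z₀ := 2) (𝕜 := ℂ) ?_ ?_ ?_
    · exact fun z _ => h1.analyticAt z
    · exact fun z _ => (differentiable_LFunction hχ).analyticAt z
    · have : {s : ℂ | 1 < s.re} ∈ 𝓝 (2:ℂ) := (isOpen_lt continuous_const continuous_re).mem_nhds (by simp)
      filter_upwards [this] with s hs
      have hs : 1 < s.re := hs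
      rw [LFunction_eq_LSeries χ⁻¹ (by simpa using hs), LFunction_eq_LSeries χ hs, LSeries, LSeries,
        Complex.conj_tsum]
      congr 1; ext n
      simp only [LSeries.term_def]
      split_ifs with h
      · simp
      · rw [map_div₀]
        congr 1
        · have := MulChar.star_apply' χ (n : ZMod q)
          rw [← this]; simp
        · rw [Complex.cpow_conj _ _ (by rw [Complex.natCast_arg]; exact Real.pi_ne_zero.symm)]
          simp
  have := congrFun h2 s
  rw [← this]; simp

/-- The archimedean factor, up to a constant. -/
noncomputable def AF (q : ℕ) (κ : ℝ) (s : ℂ) : ℂ :=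
  Complex.exp ((Real.log (q / Real.pi) / 2 : ℝ) * s) * Gamma ((s + κ) / 2)

lemma gammaFactor_eq {q : ℕ} [NeZero q] (χ : DirichletCharacter ℂ q) :
    ∃ κ : ℝ, 0 ≤ κ ∧ κ ≤ 1 ∧ ∀ s, gammaFactor χ s = (Real.pi:ℂ) ^ (-(s + κ) / 2) * Gamma ((s + κ) / 2) := by
  rcases χ.even_or_odd with h | h
  · refine ⟨0, le_rfl, zero_le_one, fun s => ?_⟩
    rw [h.gammaFactor_def, Gammaℝ_def]; simp
  · refine ⟨1, zero_le_one, le_rfl, fun s => ?_⟩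
    rw [h.gammaFactor_def, Gammaℝ_def]; simp

lemma gammaFactor_inv {q : ℕ} [NeZero q] (χ : DirichletCharacter ℂ q) :
    gammaFactor χ⁻¹ = gammaFactor χ := by
  ext s
  rcases χ.even_or_odd with h | h
  · have h' : χ⁻¹.Even := by
      rw [DirichletCharacter.Even] at h ⊢
      rw [MulChar.inv_apply_eq_inv', h]; simp
    rw [h.gammaFactor_def, h'.gammaFactor_def]
  · have h' : χ⁻¹.Odd := by
      rw [DirichletCharacter.Odd] at h ⊢
      rw [MulChar.inv_apply_eq_inv', h]; norm_num
    rw [h.gammaFactor_def, h'.gammaFactor_def]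

theorem Q_symm {q : ℕ} [NeZero q] {χ : DirichletCharacter ℂ q} (hq : 1 < q) (hprim : χ.IsPrimitive)
    (hχ : χ ≠ 1) :
    ∃ κ : ℝ, 0 ≤ κ ∧ κ ≤ 1 ∧ ∀ s : ℂ, 0 < s.re → s.re < 1 →
      ‖AF q κ (1 - conj s) * LFunction χ (1 - conj s)‖ = ‖AF q κ s * LFunction χ s‖ := by
  obtain ⟨κ, hκ0, hκ1, hκ⟩ := gammaFactor_eq χ
  refine ⟨κ, hκ0, hκ1, ?_⟩
  have hq0 : (0:ℝ) < q := by positivity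
  have hpi := Real.pi_pos
  have hne : ∀ s : ℂ, 0 < s.re → Gamma ((s + κ) / 2) ≠ 0 := by
    intro s hs
    apply Gamma_ne_zero_of_re_pos
    simp; linarith
  have hgne : ∀ s : ℂ, 0 < s.re → gammaFactor χ s ≠ 0 := by
    intro s hs
    rw [hκ]
    refine mul_ne_zero ?_ (hne s hs)
    simp [Complex.cpow_eq_zero_iff, hpi.ne']
  have h2c : conj (2:ℂ) = 2 := Complex.conj_ofReal 2
  have hconj : ∀ s : ℂ, gammaFactor χ (conj s) = conj (gammaFactor χ s) := by
    intro s
    rw [hκ, hκ, map_mul, ← Complex.Gamma_conj]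
    congr 1
    · rw [show -(conj s + κ) / 2 = conj (-(s + κ) / 2) by simp [h2c]]
      rw [Complex.cpow_conj _ _ (by rw [Complex.arg_ofReal_of_nonneg hpi.le]; exact hpi.ne)]
      simp
    · simp [h2c]
  have hcomp : ∀ s : ℂ, 0 < s.re → completedLFunction χ s = gammaFactor χ s * LFunction χ s := by
    intro s hs
    rw [LFunction_eq_completed_div_gammaFactor χ s (Or.inr hq.ne')]
    field_simp [hgne s hs]
  have hcomp' : ∀ s : ℂ, 0 < s.re → ‖completedLFunction χ⁻¹ (conj s)‖ = ‖completedLFunction χ s‖ := by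
    intro s hs
    have h1 : LFunction χ⁻¹ (conj s) = completedLFunction χ⁻¹ (conj s) / gammaFactor χ⁻¹ (conj s) :=
      LFunction_eq_completed_div_gammaFactor χ⁻¹ (conj s) (Or.inr hq.ne')
    rw [gammaFactor_inv, hconj, LFunction_conj hχ] at h1
    have h2 := congrArg norm h1
    rw [norm_div, RCLike.norm_conj, RCLike.norm_conj] at h2
    have h3 : 0 < ‖gammaFactor χ s‖ := by simpa using hgne s hs
    rw [hcomp s hs, norm_mul, h2]
    field_simp
  have hfe : ∀ s : ℂ, 0 < s.re → ‖completedLFunction χ (1 - conj s)‖ =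
      (q:ℝ) ^ (s.re - 1/2) * ‖χ.rootNumber‖ * ‖completedLFunction χ s‖ := by
    intro s hs
    rw [hprim.completedLFunction_one_sub, norm_mul, norm_mul, hcomp' s hs,
      Complex.norm_natCast_cpow_of_pos (by omega)]
    congr 3
    simp
  have hroot : ‖χ.rootNumber‖ = 1 := by
    by_contra hr
    have hz : ∀ y : ℝ, LFunction χ (1/2 + y * I) = 0 := by
      intro y
      have hre : (1/2 + y * I : ℂ).re = 1/2 := by simp
      have h1 := hfe (1/2 + y * I) (by rw [hre]; norm_num)
      have h2 : (1 - conj (1/2 + y * I : ℂ)) = 1/2 + y * I := by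
        apply Complex.ext <;> simp
        norm_num
      rw [h2, hre] at h1
      simp only [sub_self, Real.rpow_zero, one_mul] at h1
      have h3 : (1 - ‖χ.rootNumber‖) * ‖completedLFunction χ (1/2 + y * I)‖ = 0 := by linarith
      rcases mul_eq_zero.mp h3 with h | h
      · exact absurd (by linarith) hr
      · rw [LFunction_eq_completed_div_gammaFactor χ _ (Or.inr hq.ne')]
        rw [norm_eq_zero] at h
        rw [h, zero_div]
    have han : AnalyticOnNhd ℂ (LFunction χ) Set.univ := fun z _ => (differentiable_LFunction hχ).analyticAt z
    have hfr : ∃ᶠ z in 𝓝[≠] (1/2 : ℂ), LFunction χ z = 0 := by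
      have ht : Tendsto (fun y : ℝ => (1/2 + y * I : ℂ)) (𝓝[≠] 0) (𝓝[≠] (1/2)) := by
        refine tendsto_nhdsWithin_of_tendsto_nhds_of_eventually_within _ ?_ ?_
        · have : Continuous (fun y : ℝ => (1/2 + y * I : ℂ)) := by fun_prop
          have := this.tendsto 0
          simp only [ofReal_zero, zero_mul, add_zero] at this
          exact this.mono_left nhdsWithin_le_nhds
        · filter_upwards [self_mem_nhdsWithin] with y hy
          simpa using hy
      exact ht.frequently (Eventually.frequently (Eventually.of_forall hz))
    have := han.eqOn_zero_of_preconnected_of_frequently_eq_zero isPreconnected_univ (Set.mem_univ _) hfr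
      (Set.mem_univ (2:ℂ))
    exact LFunction_ne_zero_of_one_le_re χ (Or.inl hχ) (by simp) this
  have hAF : ∀ s : ℂ, 0 < s.re → ‖AF q κ s * LFunction χ s‖ =
      (q:ℝ) ^ (s.re / 2) * Real.pi ^ (κ / 2) * ‖completedLFunction χ s‖ := by
    intro s hs
    rw [hcomp s hs, hκ, AF, norm_mul, norm_mul, norm_mul, norm_mul, Complex.norm_exp,
      Complex.norm_cpow_eq_rpow_re_of_pos hpi]
    have h1 : Real.exp (((Real.log (q / Real.pi) / 2 : ℝ) * s : ℂ).re) = (q:ℝ) ^ (s.re / 2) * Real.pi ^ (-(s.re / 2)) := by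
      rw [Real.rpow_def_of_pos hq0, Real.rpow_def_of_pos hpi, ← Real.exp_add]
      congr 1
      rw [Complex.re_ofReal_mul, Real.log_div hq0.ne' hpi.ne']; ring
    have h2 : (-(s + κ) / 2 : ℂ).re = -(s.re / 2) - κ / 2 := by simp; ring
    rw [h1, h2]
    have h3 : Real.pi ^ (-(s.re / 2)) = Real.pi ^ (κ / 2) * Real.pi ^ (-(s.re / 2) - κ / 2) := by
      rw [← Real.rpow_add hpi]; congr 1; ring
    rw [h3]; ring
  intro s hs0 hs1
  have hre : (1 - conj s).re = 1 - s.re := by simp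
  rw [hAF _ (by rw [hre]; linarith), hAF s hs0, hfe s hs0, hroot, hre]
  have : (q:ℝ) ^ (s.re / 2) = (q:ℝ) ^ ((1 - s.re) / 2) * (q:ℝ) ^ (s.re - 1 / 2) := by
    rw [← Real.rpow_add hq0]; congr 1; ring
  rw [this]; ring
end GRHAux
end

section
open Complex MeasureTheory Filter Topology
namespace GRHAux
open DirichletCharacter ComplexConjugate

lemma AF_ne {q : ℕ} {κ : ℝ} (hκ : 0 ≤ κ) {s : ℂ} (hs : 0 < s.re) : AF q κ s ≠ 0 := by
  refine mul_ne_zero (Complex.exp_ne_zero _) (Gamma_ne_zero_of_re_pos ?_)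
  simp; linarith

lemma AF_diff {q : ℕ} {κ : ℝ} (hκ : 0 ≤ κ) {s : ℂ} (hs : 0 < s.re) : DifferentiableAt ℂ (AF q κ) s := by
  unfold AF
  have : DifferentiableAt ℂ (fun s : ℂ => Gamma ((s + κ) / 2)) s := by
    have h1 : DifferentiableAt ℂ Gamma ((s + κ) / 2) := gamma_diff (by simp; linarith)
    exact DifferentiableAt.comp (g := Gamma) (f := fun s : ℂ => (s + κ) / 2) s h1 (by fun_prop)
  fun_prop

lemma AF_ratio {q : ℕ} {κ a : ℝ} (hκ : 0 ≤ κ) (ha : 0 < a) (ha1 : a < 1/4) {s : ℂ} (hs : 0 ≤ s.re) :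
    ‖AF q κ (1/2 + s - a)‖ ≤ 9 * Real.exp (-(Real.log (q / Real.pi) * a)) * ‖AF q κ (1/2 + s + a)‖ := by
  set z : ℂ := (1/2 + s - a + κ) / 2 with hz
  have hzre : z.re = (1/2 + s.re - a + κ) / 2 := by simp [hz]
  have hz8 : 1/8 ≤ z.re := by rw [hzre]; linarith
  have h1 := gamma_ratio (z := z) (by linarith) ha (by linarith)
  have h2 : (z.re + a) ^ (1 - a) ≤ 9 * z.re := by
    calc (z.re + a) ^ (1 - a) ≤ (z.re + 1) ^ (1 - a) := by
          apply Real.rpow_le_rpow <;> linarith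
      _ ≤ (z.re + 1) ^ (1:ℝ) := Real.rpow_le_rpow_of_exponent_le (by linarith) (by linarith)
      _ ≤ 9 * z.re := by rw [Real.rpow_one]; linarith
  have h3 : ‖Gamma z‖ ≤ 9 * ‖Gamma (z + a)‖ := by
    have : ‖Gamma z‖ * z.re ≤ (9 * ‖Gamma (z + a)‖) * z.re := by
      calc _ ≤ _ := h1
        _ ≤ ‖Gamma (z + a)‖ * (9 * z.re) := by gcongr
        _ = _ := by ring
    exact le_of_mul_le_mul_right this (by linarith)
  unfold AF
  rw [norm_mul, norm_mul, Complex.norm_exp, Complex.norm_exp, ← hz,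
    show (1 / 2 + s + a + κ) / 2 = z + a by rw [hz]; ring, Complex.re_ofReal_mul, Complex.re_ofReal_mul]
  have h4 : Real.exp (Real.log (q / Real.pi) / 2 * (1 / 2 + s - a : ℂ).re) =
    Real.exp (-(Real.log (q / Real.pi) * a)) * Real.exp (Real.log (q / Real.pi) / 2 * (1 / 2 + s + a : ℂ).re) := by
    rw [← Real.exp_add]; congr 1; simp; ring
  rw [h4]
  calc _ ≤ Real.exp (-(Real.log (q / Real.pi) * a)) * Real.exp (Real.log (q / Real.pi) / 2 * (1 / 2 + s + a : ℂ).re) * (9 * ‖Gamma (z + a)‖) := by gcongr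
    _ = _ := by ring

theorem Q_mono (hG : GRH) {q : ℕ} [NeZero q] {χ : DirichletCharacter ℂ q} (hχ : χ ≠ 1) {κ : ℝ}
    (hκ : 0 ≤ κ) (hsym : ∀ s : ℂ, 0 < s.re → s.re < 1 →
      ‖AF q κ (1 - conj s) * LFunction χ (1 - conj s)‖ = ‖AF q κ s * LFunction χ s‖)
    {a : ℝ} (ha : 0 < a) (ha1 : a < 1/4) {s : ℂ} (hs : 0 ≤ s.re) :
    ‖AF q κ (1/2 + s - a) * LFunction χ (1/2 + s - a)‖ ≤
      ‖AF q κ (1/2 + s + a) * LFunction χ (1/2 + s + a)‖ := by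
  have hq0 : (0:ℝ) < q := by exact_mod_cast Nat.pos_of_ne_zero (NeZero.ne q)
  let Q : ℂ → ℂ := fun s => AF q κ s * LFunction χ s
  have hQd : ∀ s : ℂ, 0 < s.re → DifferentiableAt ℂ Q s := fun s hs =>
    (AF_diff hκ hs).mul (differentiable_LFunction hχ s)
  have hQne : ∀ s : ℂ, 1/2 < s.re → Q s ≠ 0 := fun s hs =>
    mul_ne_zero (AF_ne hκ (by linarith)) (L_ne_zero hG hχ hs)
  let f : ℂ → ℂ := fun s => Q (1/2 + s - a) / Q (1/2 + s + a)
  have hre1 : ∀ s : ℂ, (1/2 + s - a : ℂ).re = 1/2 + s.re - a := by intro s; simp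
  have hre2 : ∀ s : ℂ, (1/2 + s + a : ℂ).re = 1/2 + s.re + a := by intro s; simp
  obtain ⟨C, hC, hgrow⟩ := growth hG hχ ha (by linarith)
  set E := 9 * Real.exp (-(Real.log (q / Real.pi) * a)) with hE
  have hE0 : 0 < E := by positivity
  have hL0 : ∀ s : ℂ, 0 ≤ s.re → 0 < ‖LFunction χ (1/2 + s + a)‖ := by
    intro s hs
    have := L_ne_zero hG hχ (s := 1/2 + s + a) (by rw [hre2]; linarith)
    simpa using this
  have hfb : ∀ s : ℂ, 0 ≤ s.re → ‖f s‖ ≤ E * (‖LFunction χ (1/2 + s - a)‖ / ‖LFunction χ (1/2 + s + a)‖) := by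
    intro s hs
    simp only [f, Q]
    have h1 := AF_ratio (q := q) hκ ha ha1 hs
    have h2 : 0 < ‖AF q κ (1/2 + s + a)‖ := by
      have : AF q κ (1/2 + s + a) ≠ 0 := AF_ne hκ (by rw [hre2]; linarith)
      simpa using this
    have h3 := hL0 s hs
    rw [norm_div, norm_mul, norm_mul, div_le_iff₀ (by positivity)]
    calc _ ≤ (E * ‖AF q κ (1/2 + s + a)‖) * ‖LFunction χ (1/2 + s - a)‖ := by gcongr
      _ = _ := by
        generalize ‖AF q κ (1/2 + s + a)‖ = X at *
        generalize ‖LFunction χ (1/2 + s + a)‖ = Y at *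
        field_simp
  have key : ‖f s‖ ≤ 1 := by
    refine PhragmenLindelof.right_half_plane_of_bounded_on_real ?_ ?_ ?_ ?_ hs
    · apply DifferentiableOn.diffContOnCl
      intro z hz
      have hz0 : 0 ≤ z.re := by
        have : closure {z : ℂ | 0 < z.re} ⊆ {z | 0 ≤ z.re} :=
          closure_minimal (fun z (hz : 0 < z.re) => (le_of_lt hz : 0 ≤ z.re)) (isClosed_le continuous_const continuous_re)
        exact this hz
      have e1 : DifferentiableAt ℂ (fun s : ℂ => Q (1/2 + s - a)) z :=
        DifferentiableAt.comp (g := Q) (f := fun s : ℂ => 1/2 + s - a) z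
          (hQd _ (by rw [hre1]; linarith)) (by fun_prop)
      have e2 : DifferentiableAt ℂ (fun s : ℂ => Q (1/2 + s + a)) z :=
        DifferentiableAt.comp (g := Q) (f := fun s : ℂ => 1/2 + s + a) z
          (hQd _ (by rw [hre2]; linarith)) (by fun_prop)
      exact (e1.div e2 (hQne _ (by rw [hre2]; linarith))).differentiableWithinAt
    · refine ⟨1, by norm_num, 1 + C, ?_⟩
      refine Asymptotics.IsBigO.of_bound (E * (4 * q * Real.exp (2 * C))) ?_
      rw [eventually_inf_principal]
      refine Eventually.of_forall fun z hz => ?_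
      have hz : 0 < z.re := hz
      have n1 : ‖(1/2 + z - a : ℂ)‖ ≤ 1 + ‖z‖ := by
        calc _ = ‖((1/2 - a : ℝ) : ℂ) + z‖ := by congr 1; push_cast; ring
          _ ≤ ‖((1/2 - a : ℝ) : ℂ)‖ + ‖z‖ := norm_add_le _ _
          _ ≤ _ := by
            rw [Complex.norm_real, Real.norm_of_nonneg (by linarith)]; linarith
      have n2 : ‖(1/2 + z + a : ℂ)‖ ≤ 1 + ‖z‖ := by
        calc _ = ‖((1/2 + a : ℝ) : ℂ) + z‖ := by congr 1; push_cast; ring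
          _ ≤ ‖((1/2 + a : ℝ) : ℂ)‖ + ‖z‖ := norm_add_le _ _
          _ ≤ _ := by
            rw [Complex.norm_real, Real.norm_of_nonneg (by linarith)]; linarith
      have b1 : ‖LFunction χ (1/2 + z - a)‖ ≤ 4 * q * Real.exp ‖z‖ := by
        refine (LFunction_bound hχ (by rw [hre1]; linarith)).trans ?_
        rw [div_le_iff₀ (by rw [hre1]; linarith), hre1]
        have hex := Real.add_one_le_exp ‖z‖
        calc (q:ℝ) * ‖(1/2 + z - a : ℂ)‖ ≤ q * Real.exp ‖z‖ := by gcongr; linarith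
          _ = 4 * q * Real.exp ‖z‖ * (1/4) := by ring
          _ ≤ _ := by gcongr; linarith
      have b2 : (‖LFunction χ (1/2 + z + a)‖)⁻¹ ≤ Real.exp (2 * C + C * ‖z‖) := by
        have := (hgrow (1/2 + z + a) (by rw [hre2]; linarith)).2
        rw [inv_le_comm₀ (hL0 z hz.le) (Real.exp_pos _), ← Real.exp_neg]
        refine le_trans (Real.exp_le_exp.mpr ?_) this
        have : √(1 + ‖(1/2 + z + a : ℂ)‖) ≤ 2 + ‖z‖ := by
          rw [Real.sqrt_le_left (by positivity)]
          nlinarith [norm_nonneg z]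
        nlinarith
      rw [Real.norm_of_nonneg (Real.exp_pos _).le, Real.rpow_one]
      calc _ ≤ _ := hfb z hz.le
        _ = E * (‖LFunction χ (1/2 + z - a)‖ * (‖LFunction χ (1/2 + z + a)‖)⁻¹) := by rw [div_eq_mul_inv]
        _ ≤ E * (4 * q * Real.exp ‖z‖ * Real.exp (2 * C + C * ‖z‖)) := by gcongr
        _ = E * (4 * q * Real.exp (2 * C)) * Real.exp ((1 + C) * ‖z‖) := by
          rw [show Real.exp (2 * C + C * ‖z‖) = Real.exp (2 * C) * Real.exp (C * ‖z‖) from Real.exp_add _ _,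
            show (1 + C) * ‖z‖ = ‖z‖ + C * ‖z‖ by ring, Real.exp_add]
          ring
    · refine ⟨E * (q * 5), ?_⟩
      rw [eventually_map]
      filter_upwards [eventually_ge_atTop 2] with x hx
      have hx0 : 0 ≤ (x:ℂ).re := by simp; linarith
      refine (hfb x hx0).trans ?_
      have b1 : ‖LFunction χ (1/2 + x - a)‖ ≤ q := by
        refine (LFunction_bound hχ (by rw [hre1]; simp; linarith)).trans ?_
        rw [div_le_iff₀ (by rw [hre1]; simp; linarith), hre1]
        have : (1/2 + x - a : ℂ) = ((1/2 + x - a : ℝ) : ℂ) := by push_cast; ring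
        rw [this, Complex.norm_real, Real.norm_of_nonneg (by linarith)]
        simp
      have b2 : 1/5 ≤ ‖LFunction χ (1/2 + x + a)‖ := L_lower χ (by rw [hre2]; simp; linarith)
      gcongr
      rw [div_le_iff₀ (by linarith)]
      nlinarith
    · intro y
      have h1 : (1 - conj (1/2 + y * I + a : ℂ)) = 1/2 + y * I - a := by
        apply Complex.ext <;> simp
        ring
      have h2 := hsym (1/2 + y * I + a) (by simp; linarith) (by simp; linarith)
      rw [h1] at h2
      simp only [f, Q]
      rw [norm_div, h2]
      exact div_self_le_one _
  simp only [f, Q] at key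
  rw [norm_div, div_le_one] at key
  · exact key
  · have := hQne (1/2 + s + a) (by rw [hre2]; linarith)
    exact norm_pos_iff.mpr this

theorem Q_pos (hG : GRH) {q : ℕ} [NeZero q] {χ : DirichletCharacter ℂ q} (hχ : χ ≠ 1) {κ : ℝ}
    (hκ : 0 ≤ κ) (hsym : ∀ s : ℂ, 0 < s.re → s.re < 1 →
      ‖AF q κ (1 - conj s) * LFunction χ (1 - conj s)‖ = ‖AF q κ s * LFunction χ s‖)
    {s : ℂ} (hs : 1/2 < s.re) : 0 ≤ (logDeriv (AF q κ) s).re + (logDeriv (LFunction χ) s).re := by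
  let Q : ℂ → ℂ := fun s => AF q κ s * LFunction χ s
  have hs0 : 0 < s.re := by linarith
  have hQd : DifferentiableAt ℂ Q s := (AF_diff hκ hs0).mul (differentiable_LFunction hχ s)
  have hQne : Q s ≠ 0 := mul_ne_zero (AF_ne hκ hs0) (L_ne_zero hG hχ hs)
  have hlog : logDeriv Q s = logDeriv (AF q κ) s + logDeriv (LFunction χ) s :=
    logDeriv_mul (f := AF q κ) (g := LFunction χ) s (AF_ne hκ hs0) (L_ne_zero hG hχ hs) (AF_diff hκ hs0) (differentiable_LFunction hχ s)
  rw [← Complex.add_re, ← hlog]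
  have h1 : HasDerivAt (fun x : ℝ => Real.log ‖Q (s + x)‖) (logDeriv Q s).re 0 := by
    have := hasDerivAt_log_norm (f := Q) (z := s) (a := 0) (by simpa using hQd) (by simpa using hQne)
    simpa using this
  have h2 : HasDerivAt (fun x : ℝ => Real.log ‖Q (s + (-x : ℝ))‖) (-(logDeriv Q s).re) 0 := by
    have h1' : HasDerivAt (fun x : ℝ => Real.log ‖Q (s + x)‖) (logDeriv Q s).re (-0) := by simpa using h1
    have := h1'.comp (0:ℝ) (hasDerivAt_neg (0:ℝ))
    simpa [Function.comp_def] using this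
  have h3 := h1.sub h2
  have h4 := deriv_nonneg_of_right (e := min (1/4) (s.re - 1/2)) (by simp; linarith) h3 (by simp) ?_
  · linarith
  · intro a ha hlt
    have hlt1 : a < 1/4 := lt_of_lt_of_le hlt (min_le_left _ _)
    have hlt2 : a < s.re - 1/2 := lt_of_lt_of_le hlt (min_le_right _ _)
    have := Q_mono hG hχ hκ hsym ha hlt1 (s := s - 1/2) (by simp; linarith)
    rw [show 1/2 + (s - 1/2) - (a:ℂ) = s + (-a : ℝ) by push_cast; ring,
      show 1/2 + (s - 1/2) + (a:ℂ) = s + a by ring] at this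
    have hp : Q (s + (-a : ℝ)) ≠ 0 :=
      mul_ne_zero (AF_ne hκ (by simp; linarith)) (L_ne_zero hG hχ (by simp; linarith))
    have := Real.log_le_log (norm_pos_iff.mpr hp) this
    simpa [Q] using this
end GRHAux
end

section
open Complex MeasureTheory Filter Topology
namespace GRHAux
open DirichletCharacter ComplexConjugate
open ArithmeticFunction (vonMangoldt)

noncomputable def VV (σ : ℝ) : ℝ := ∑' n : ℕ, vonMangoldt n * (n:ℝ) ^ (-σ)

lemma VV_summable {σ : ℝ} (hσ : 1 < σ) : Summable fun n : ℕ => vonMangoldt n * (n:ℝ) ^ (-σ) := by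
  have h := (ArithmeticFunction.LSeriesSummable_vonMangoldt (s := (σ:ℂ)) (by simpa using hσ)).norm
  refine h.congr fun n => ?_
  rw [LSeries.norm_term_eq]
  split_ifs with h0
  · simp [h0]
  · rw [Complex.norm_real, Real.norm_of_nonneg (ArithmeticFunction.vonMangoldt_nonneg), Real.rpow_neg (by positivity)]
    simp [div_eq_mul_inv]

lemma VV_term_nonneg (σ : ℝ) (n : ℕ) : 0 ≤ vonMangoldt n * (n:ℝ) ^ (-σ) :=
  mul_nonneg ArithmeticFunction.vonMangoldt_nonneg (by positivity)

lemma VV_nonneg (σ : ℝ) : 0 ≤ VV σ := tsum_nonneg (VV_term_nonneg σ)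

lemma VV_anti {σ σ' : ℝ} (hσ : 1 < σ) (h : σ ≤ σ') : VV σ' ≤ VV σ := by
  refine Summable.tsum_le_tsum (fun n => ?_) (VV_summable (by linarith)) (VV_summable hσ)
  rcases Nat.eq_zero_or_pos n with rfl | hn
  · simp
  · refine mul_le_mul_of_nonneg_left ?_ ArithmeticFunction.vonMangoldt_nonneg
    exact Real.rpow_le_rpow_of_exponent_le (by exact_mod_cast hn) (by linarith)

lemma logDeriv_hasSum {q : ℕ} [NeZero q] (χ : DirichletCharacter ℂ q) {s : ℂ} (hs : 1 < s.re) :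
    HasSum (fun n : ℕ => (vonMangoldt n : ℂ) * χ (n : ZMod q) * (n:ℂ) ^ (-s)) (-logDeriv (LFunction χ) s) := by
  have h1 := LSeries_twist_vonMangoldt_eq χ hs
  have h2 : LSeriesSummable ((fun n : ℕ => χ (n : ZMod q)) * fun n : ℕ => (vonMangoldt n : ℂ)) s :=
    LSeriesSummable_twist_vonMangoldt χ hs
  have h3 := h2.hasSum
  rw [show (∑' n, LSeries.term ((fun n : ℕ => χ (n : ZMod q)) * fun n : ℕ => (vonMangoldt n : ℂ)) s n) =
    -logDeriv (LFunction χ) s by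
      rw [logDeriv_apply, deriv_LFunction_eq_deriv_LSeries χ hs, LFunction_eq_LSeries χ hs, ← neg_div]
      exact h1] at h3
  convert h3 using 1
  ext n
  rw [LSeries.term_def]
  split_ifs with h0
  · simp [h0]
  · rw [Complex.cpow_neg, div_eq_mul_inv]; simp only [Pi.mul_apply]; ring

lemma term_norm_le {q : ℕ} (χ : DirichletCharacter ℂ q) (s : ℂ) (n : ℕ) :
    ‖(vonMangoldt n : ℂ) * χ (n : ZMod q) * (n:ℂ) ^ (-s)‖ ≤ vonMangoldt n * (n:ℝ) ^ (-s.re) := by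
  rcases Nat.eq_zero_or_pos n with rfl | hn
  · simp
  · rw [norm_mul, norm_mul, Complex.norm_real, Real.norm_of_nonneg ArithmeticFunction.vonMangoldt_nonneg,
      Complex.norm_natCast_cpow_of_pos hn, Complex.neg_re]
    have h1 := χ.norm_le_one (n : ZMod q)
    have h2 : 0 ≤ vonMangoldt n := ArithmeticFunction.vonMangoldt_nonneg
    have h3 : (0:ℝ) ≤ (n:ℝ) ^ (-s.re) := by positivity
    calc _ ≤ vonMangoldt n * 1 * (n:ℝ) ^ (-s.re) := by gcongr
      _ = _ := by ring

lemma logDeriv_le_VV {q : ℕ} [NeZero q] (χ : DirichletCharacter ℂ q) {σ : ℝ} (hσ : 1 < σ) {s : ℂ} (hs : σ ≤ s.re) :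
    ‖logDeriv (LFunction χ) s‖ ≤ VV σ := by
  have hs1 : 1 < s.re := by linarith
  have h1 := logDeriv_hasSum χ hs1
  rw [← norm_neg, ← h1.tsum_eq]
  refine (tsum_of_norm_bounded (VV_summable hs1).hasSum (term_norm_le χ s)).trans ?_
  exact VV_anti hσ hs

lemma VV_bound {δ : ℝ} (hδ : 0 < δ) (hδ1 : δ ≤ 1) : VV (1 + δ) ≤ 6 / δ ^ 2 := by
  have hterm : ∀ n : ℕ, vonMangoldt n * (n:ℝ) ^ (-(1 + δ)) ≤ 2 / δ * (n:ℝ) ^ (-(1 + δ/2)) := by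
    intro n
    rcases Nat.eq_zero_or_pos n with rfl | hn
    · simp; positivity
    · have hn' : (0:ℝ) < n := by exact_mod_cast hn
      have h1 : vonMangoldt n ≤ 2 / δ * (n:ℝ) ^ (δ/2) := by
        calc _ ≤ Real.log n := ArithmeticFunction.vonMangoldt_le_log
          _ ≤ (n:ℝ) ^ (δ/2) / (δ/2) := Real.log_le_rpow_div hn'.le (by positivity)
          _ = _ := by field_simp
      calc _ ≤ 2 / δ * (n:ℝ) ^ (δ/2) * (n:ℝ) ^ (-(1 + δ)) := by gcongr
        _ = _ := by rw [mul_assoc, ← Real.rpow_add hn']; congr 2; ring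
  have hη : 0 < δ / 2 := by positivity
  have hsum : ∀ N : ℕ, ∑ n ∈ Finset.range N, (n:ℝ) ^ (-(1 + δ/2)) ≤ 3 / δ := by
    intro N
    have h0 : ((0:ℕ):ℝ) ^ (-(1 + δ/2)) = 0 := by
      rw [Nat.cast_zero, Real.zero_rpow (by linarith)]
    calc _ ≤ ∑ n ∈ Finset.range (N + 2), (n:ℝ) ^ (-(1 + δ/2)) := by
          apply Finset.sum_le_sum_of_subset_of_nonneg
          · intro i; simp; omega
          · intros; positivity
      _ = ∑ n ∈ Finset.range N, ((1:ℝ) + ((n + 1 : ℕ):ℝ)) ^ (-(1 + δ/2)) + 1 := by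
          rw [Finset.sum_range_succ', Finset.sum_range_succ', h0]
          have : ∀ k ∈ Finset.range N, ((k + 1 + 1 : ℕ):ℝ) ^ (-(1 + δ/2)) = ((1:ℝ) + ((k + 1 : ℕ):ℝ)) ^ (-(1 + δ/2)) := by
            intro k _; congr 1; push_cast; ring
          rw [Finset.sum_congr rfl this]; simp
      _ ≤ (∫ x in (1:ℝ)..(1 + N), x ^ (-(1 + δ/2))) + 1 := by
          gcongr
          apply AntitoneOn.sum_le_integral (f := fun x : ℝ => x ^ (-(1 + δ/2)))
          intro x hx y hy hxy
          have : 0 < x := by linarith [hx.1]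
          exact Real.rpow_le_rpow_of_nonpos this hxy (by linarith)
      _ = (1 - (1 + N:ℝ) ^ (-(δ/2))) / (δ/2) + 1 := by
          rw [integral_rpow]
          · rw [show -(1 + δ/2) + 1 = -(δ/2) by ring, Real.one_rpow, div_neg, ← neg_div]; ring
          · right
            refine ⟨by linarith, ?_⟩
            rw [Set.uIcc_of_le (by linarith [Nat.cast_nonneg (α := ℝ) N])]
            simp
      _ ≤ 1 / (δ/2) + 1 := by
          have : 0 ≤ (1 + N:ℝ) ^ (-(δ/2)) := by positivity
          gcongr; linarith
      _ ≤ 3 / δ := by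
          rw [one_div_div, show 3 / δ = 2 / δ + 1 / δ by ring]
          gcongr
          rw [le_div_iff₀ hδ]; linarith
  refine Real.tsum_le_of_sum_range_le (VV_term_nonneg _) fun N => ?_
  calc _ ≤ ∑ n ∈ Finset.range N, 2 / δ * (n:ℝ) ^ (-(1 + δ/2)) := Finset.sum_le_sum fun n _ => hterm n
    _ = 2 / δ * ∑ n ∈ Finset.range N, (n:ℝ) ^ (-(1 + δ/2)) := by rw [Finset.mul_sum]
    _ ≤ 2 / δ * (3 / δ) := by gcongr; exact hsum N
    _ = _ := by field_simp; norm_num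

lemma AF_logDeriv {q : ℕ} {κ : ℝ} (hκ : 0 ≤ κ) {s : ℂ} (hs : 0 < s.re) :
    logDeriv (AF q κ) s = (Real.log (q / Real.pi) / 2 : ℝ) + logDeriv Gamma ((s + κ) / 2) / 2 := by
  have hz : 0 < ((s + κ) / 2 : ℂ).re := by simp; linarith
  have h1 : HasDerivAt (fun s : ℂ => Gamma ((s + κ) / 2)) (deriv Gamma ((s + κ) / 2) * (1 / 2)) s := by
    have h2 : HasDerivAt (fun s : ℂ => (s + κ) / 2) (1 / 2) s := ((hasDerivAt_id s).add_const (κ:ℂ)).div_const 2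
    exact (gamma_diff hz).hasDerivAt.comp s h2
  have h3 : HasDerivAt (fun s : ℂ => Complex.exp ((Real.log (q / Real.pi) / 2 : ℝ) * s))
      (Complex.exp ((Real.log (q / Real.pi) / 2 : ℝ) * s) * ((Real.log (q / Real.pi) / 2 : ℝ) * 1)) s :=
    ((hasDerivAt_id s).const_mul _).cexp
  have h4 := (h3.mul h1).deriv
  have h5 : (AF q κ) = (fun s : ℂ => Complex.exp ((Real.log (q / Real.pi) / 2 : ℝ) * s)) * (fun s : ℂ => Gamma ((s + κ) / 2)) := by
    ext s; rfl
  rw [logDeriv_apply, logDeriv_apply, h5, h4]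
  simp only [Pi.mul_apply]
  have e1 := Complex.exp_ne_zero ((Real.log (q / Real.pi) / 2 : ℝ) * s)
  have e2 := Gamma_ne_zero_of_re_pos hz
  field_simp

theorem majorant (hG : GRH) : ∃ C > 0, ∀ (q : ℕ) (_ : NeZero q) (χ : DirichletCharacter ℂ q), 1 < q →
    χ.IsPrimitive → χ ≠ 1 → ∃ g : ℂ → ℂ, DifferentiableOn ℂ g {s | 1/2 < s.re} ∧
      (∀ s : ℂ, 1/2 < s.re → |(logDeriv (LFunction χ) s).re| ≤ (g s).re) ∧
      ∀ D : ℝ, 1 ≤ D → ∀ t σ : ℝ, 1/2 < σ → σ ≤ 1 → ∃ d, D ≤ d ∧ d ≤ D + 2 ∧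
        (g (σ + d + t * I)).re ≤ C * Real.log (q * (D + |t| + 2)) := by
  refine ⟨1 + (VV (3/2) + 8) / Real.log 2, by have := VV_nonneg (3/2); positivity, ?_⟩
  intro q _ χ hq hprim hχ
  obtain ⟨κ, hκ0, hκ1, hsym⟩ := Q_symm hq hprim hχ
  have hq2 : (2:ℝ) ≤ q := by exact_mod_cast hq
  have hpi := Real.pi_pos
  refine ⟨fun s => 2 * logDeriv (AF q κ) s + logDeriv (LFunction χ) s + 8, ?_, ?_, ?_⟩
  · have hopen : IsOpen {s : ℂ | 1/2 < s.re} := isOpen_lt continuous_const continuous_re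
    have hd : ∀ f : ℂ → ℂ, (∀ s : ℂ, 1/2 < s.re → DifferentiableAt ℂ f s ∧ f s ≠ 0) →
        DifferentiableOn ℂ (logDeriv f) {s | 1/2 < s.re} := by
      intro f hf s hs
      have h1 : DifferentiableOn ℂ f {s : ℂ | 1/2 < s.re} := fun s hs => (hf s hs).1.differentiableWithinAt
      have h2 := (h1.deriv hopen).differentiableAt (hopen.mem_nhds hs)
      exact (h2.div (hf s hs).1 (hf s hs).2).differentiableWithinAt
    have hA := hd (AF q κ) (fun s hs => ⟨AF_diff hκ0 (by linarith), AF_ne hκ0 (by linarith)⟩)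
    have hL := hd (LFunction χ) (fun s hs => ⟨differentiable_LFunction hχ s, L_ne_zero hG hχ hs⟩)
    exact ((hA.const_mul 2).add hL).add_const 8
  · intro s hs
    have h1 := Q_pos hG hχ hκ0 hsym hs
    have h2 : -4 ≤ (logDeriv (AF q κ) s).re := by
      rw [AF_logDeriv hκ0 (by linarith)]
      have h3 := digamma_lower (z := (s + κ) / 2) (by simp; linarith)
      have h4 : -1 ≤ Real.log (q / Real.pi) := by
        have h5 : Real.log (Real.pi / q) ≤ 1 := by
          have := Real.log_le_sub_one_of_pos (show 0 < Real.pi / q by positivity)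
          have h6 : Real.pi / q ≤ 2 := by
            rw [div_le_iff₀ (by linarith)]; linarith [Real.pi_le_four]
          linarith
        rw [← inv_div, Real.log_inv] at h5; linarith
      have : ((Real.log (q / Real.pi) / 2 : ℝ) + logDeriv Gamma ((s + κ) / 2) / 2 : ℂ).re =
        Real.log (q / Real.pi) / 2 + (logDeriv Gamma ((s + κ) / 2)).re / 2 := by
        rw [Complex.add_re, Complex.ofReal_re]; simp
      rw [this]; linarith
    have : (2 * logDeriv (AF q κ) s + logDeriv (LFunction χ) s + 8).re =
      2 * (logDeriv (AF q κ) s).re + (logDeriv (LFunction χ) s).re + 8 := by simp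
    rw [this, abs_le]
    constructor <;> linarith
  · intro D hD t σ hσ hσ1
    set z0 : ℂ := (σ + D + κ + t * I) / 2 with hz0
    have hz0re : z0.re = (σ + D + κ) / 2 := by simp [hz0]
    obtain ⟨θ, hθ, hmvt⟩ := digamma_mvt (z := z0) (by rw [hz0re]; linarith)
    refine ⟨D + 2 * θ, by linarith [hθ.1], by linarith [hθ.2], ?_⟩
    set s : ℂ := σ + ((D + 2 * θ : ℝ) : ℂ) + t * I with hs
    have hsre : s.re = σ + (D + 2 * θ) := by simp [hs]
    have e1 : (2 * logDeriv (AF q κ) s + logDeriv (LFunction χ) s + 8).re =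
      2 * (logDeriv (AF q κ) s).re + (logDeriv (LFunction χ) s).re + 8 := by simp
    have e2 : (logDeriv (AF q κ) s).re = Real.log (q / Real.pi) / 2 + Real.log ‖z0‖ / 2 := by
      rw [AF_logDeriv hκ0 (by rw [hsre]; linarith [hθ.1]), Complex.add_re, Complex.ofReal_re]
      rw [show (s + κ) / 2 = z0 + θ by rw [hs, hz0]; push_cast; ring, ← hmvt]
      simp
    have e3 : (logDeriv (LFunction χ) s).re ≤ VV (3/2) :=
      (Complex.re_le_norm _).trans (logDeriv_le_VV χ (by norm_num) (by rw [hsre]; linarith [hθ.1]))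
    have e4 : Real.log (q / Real.pi) ≤ Real.log q := by
      apply Real.log_le_log (by positivity)
      apply div_le_self (by linarith)
      linarith [Real.pi_gt_three]
    have hz0n : 0 < ‖z0‖ := by
      rw [norm_pos_iff]; intro h; rw [h] at hz0re; simp at hz0re; linarith
    have e5 : Real.log ‖z0‖ ≤ Real.log (D + |t| + 2) := by
      apply Real.log_le_log hz0n
      have : ‖z0‖ ≤ |z0.re| + |z0.im| := Complex.norm_le_abs_re_add_abs_im z0
      have him : z0.im = t / 2 := by simp [hz0]
      rw [hz0re, him, abs_of_nonneg (show 0 ≤ (σ + D + κ) / 2 by linarith), abs_div,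
        abs_of_pos (show (0:ℝ) < 2 by norm_num)] at this
      linarith [abs_nonneg t]
    have hDt : 3 ≤ D + |t| + 2 := by linarith [abs_nonneg t]
    have e6 : Real.log (q * (D + |t| + 2)) = Real.log q + Real.log (D + |t| + 2) :=
      Real.log_mul (by linarith) (by linarith)
    have e7 : Real.log 2 ≤ Real.log (q * (D + |t| + 2)) := by
      apply Real.log_le_log (by norm_num); nlinarith
    have e8 : 0 < Real.log 2 := Real.log_pos (by norm_num)
    have e9 : VV (3/2) + 8 ≤ (VV (3/2) + 8) / Real.log 2 * Real.log (q * (D + |t| + 2)) := by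
      have := VV_nonneg (3/2)
      rw [div_mul_eq_mul_div, le_div_iff₀ e8]
      gcongr
    show (2 * logDeriv (AF q κ) s + logDeriv (LFunction χ) s + 8).re ≤ _
    rw [e1, e2, add_mul, one_mul]
    linarith
end GRHAux
end

section
open Complex MeasureTheory Filter Topology
namespace GRHAux
open DirichletCharacter ComplexConjugate
open ArithmeticFunction (vonMangoldt)

noncomputable def KK (x : ℝ) (s : ℂ) : ℂ :=
  (((x + √x : ℝ) : ℂ) ^ (s + 1) - (x:ℂ) ^ (s + 1)) / (√x * (s * (s + 1)))

lemma KK_diff {x : ℝ} (hx : 1 ≤ x) {s : ℂ} (hs : 0 < s.re) : DifferentiableAt ℂ (KK x) s := by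
  have hx0 : 0 < x := by linarith
  have hsx : 0 < √x := Real.sqrt_pos.mpr hx0
  have h1 : ((x + √x : ℝ) : ℂ) ≠ 0 := by
    rw [Complex.ofReal_ne_zero]; positivity
  have h2 : (x : ℂ) ≠ 0 := by rw [Complex.ofReal_ne_zero]; positivity
  have h3 : s ≠ 0 := by rintro rfl; simp at hs
  have h4 : s + 1 ≠ 0 := by intro h; have := congrArg Complex.re h; simp at this; linarith
  have h5 : ((√x:ℝ):ℂ) ≠ 0 := by rw [Complex.ofReal_ne_zero]; positivity
  unfold KK
  refine DifferentiableAt.div ?_ (by fun_prop) (by simp [h3, h4, h5])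
  refine DifferentiableAt.sub ?_ ?_
  · exact (by fun_prop : DifferentiableAt ℂ (fun s : ℂ => s + 1) s).const_cpow (Or.inl h1)
  · exact (by fun_prop : DifferentiableAt ℂ (fun s : ℂ => s + 1) s).const_cpow (Or.inl h2)

lemma sqrt_le_self' {x : ℝ} (hx : 1 ≤ x) : √x ≤ x := by
  rw [Real.sqrt_le_left (by linarith)]; nlinarith

lemma KK_bound1 {x : ℝ} (hx : 1 ≤ x) {s : ℂ} (hs : 0 < s.re) : ‖KK x s‖ ≤ (2 * x) ^ s.re / ‖s‖ := by
  have hx0 : 0 < x := by linarith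
  have hsx : 0 < √x := Real.sqrt_pos.mpr hx0
  have hsx' := sqrt_le_self' hx
  have h3 : s ≠ 0 := by rintro rfl; simp at hs
  have h4 : s + 1 ≠ 0 := by intro h; have := congrArg Complex.re h; simp at this; linarith
  have hmv : ‖((x + √x : ℝ) : ℂ) ^ (s + 1) - (x:ℂ) ^ (s + 1)‖ ≤ (‖s + 1‖ * (2 * x) ^ s.re) * ‖(x + √x) - x‖ := by
    refine (convex_Icc x (x + √x)).norm_image_sub_le_of_norm_hasDerivWithin_le
      (f := fun y : ℝ => (y:ℂ) ^ (s + 1)) (f' := fun y : ℝ => (s + 1) * (y:ℂ) ^ s) (fun y hy => ?_) (fun y hy => ?_)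
      ⟨le_rfl, by linarith⟩ ⟨by linarith, le_rfl⟩
    · have hy0 : 0 < y := by linarith [hy.1]
      have := (Complex.hasStrictDerivAt_cpow_const (x := (y:ℂ)) (c := s + 1) (Or.inl (by simpa using hy0))).hasDerivAt.comp_ofReal
      simp only [add_sub_cancel_right] at this
      exact this.hasDerivWithinAt
    · have hy0 : 0 < y := by linarith [hy.1]
      rw [norm_mul, Complex.norm_cpow_eq_rpow_re_of_pos hy0]
      gcongr
      linarith [hy.2]
  rw [add_sub_cancel_left, Real.norm_of_nonneg hsx.le] at hmv
  have p3 : 0 < ‖s‖ := norm_pos_iff.mpr h3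
  have p4 : 0 < ‖s + 1‖ := norm_pos_iff.mpr h4
  unfold KK
  rw [norm_div, norm_mul, norm_mul, Complex.norm_real, Real.norm_of_nonneg hsx.le, div_le_div_iff₀ (by positivity) p3]
  calc _ ≤ (‖s + 1‖ * (2 * x) ^ s.re) * √x * ‖s‖ := by gcongr
    _ = _ := by ring

lemma KK_bound2 {x : ℝ} (hx : 1 ≤ x) {s : ℂ} (hs : 0 < s.re) :
    ‖KK x s‖ ≤ 2 * (2 * x) ^ (s.re + 1) / (√x * (‖s‖ * ‖s + 1‖)) := by
  have hx0 : 0 < x := by linarith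
  have hsx : 0 < √x := Real.sqrt_pos.mpr hx0
  have hsx' := sqrt_le_self' hx
  unfold KK
  rw [norm_div, norm_mul, norm_mul, Complex.norm_real, Real.norm_of_nonneg hsx.le]
  gcongr
  calc _ ≤ ‖((x + √x : ℝ) : ℂ) ^ (s + 1)‖ + ‖(x:ℂ) ^ (s + 1)‖ := norm_sub_le _ _
    _ = (x + √x) ^ (s.re + 1) + x ^ (s.re + 1) := by
      rw [Complex.norm_cpow_eq_rpow_re_of_pos (by positivity), Complex.norm_cpow_eq_rpow_re_of_pos hx0]; simp
    _ ≤ (2 * x) ^ (s.re + 1) + (2 * x) ^ (s.re + 1) := by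
      gcongr <;> linarith
    _ = _ := by ring

lemma norm_lower {α : ℝ} (hα : 0 < α) {s : ℂ} (hs : α ≤ s.re) : min α 1 / 2 * (1 + |s.im|) ≤ ‖s‖ := by
  have h := denom_bound (c := s.re) (by linarith) s.im
  rw [Complex.re_add_im] at h
  refine le_trans ?_ h
  gcongr

lemma PhiK_decay {x α β C : ℝ} (hx : 1 ≤ x) (hα : 0 < α) (hC : 0 ≤ C) {Φ : ℂ → ℂ}
    (hΦ : ∀ s : ℂ, α ≤ s.re → s.re ≤ β → ‖Φ s‖ ≤ C * √(1 + ‖s‖)) :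
    ∃ M, ∀ s : ℂ, α ≤ s.re → s.re ≤ β → ‖Φ s * KK x s‖ ≤ M * (1 + |s.im|) ^ (-(3/2) : ℝ) := by
  have hsx : 0 < √x := Real.sqrt_pos.mpr (by linarith)
  set m := min α 1 / 2 with hm
  have hm0 : 0 < m := by positivity
  refine ⟨C * √(1 + β) * (2 * (2 * x) ^ (β + 1) / (√x * (m * m))), fun s h1 h2 => ?_⟩
  have hs0 : 0 < s.re := by linarith
  have hβ : 0 < β := by linarith
  set v := 1 + |s.im| with hv
  have hv1 : 1 ≤ v := by linarith [abs_nonneg s.im]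
  have hn1 : m * v ≤ ‖s‖ := norm_lower hα h1
  have hn2 : m * v ≤ ‖s + 1‖ := by
    have := norm_lower (s := s + 1) hα (by simp; linarith)
    simpa using this
  have hn3 : ‖s‖ ≤ β + |s.im| := by
    have := Complex.norm_le_abs_re_add_abs_im s
    rw [abs_of_pos hs0] at this; linarith
  have e1 : √(1 + ‖s‖) ≤ √(1 + β) * v ^ (1/2:ℝ) := by
    rw [← Real.sqrt_eq_rpow, ← Real.sqrt_mul (by linarith)]
    apply Real.sqrt_le_sqrt
    nlinarith [abs_nonneg s.im]
  have e2 : ‖KK x s‖ ≤ 2 * (2 * x) ^ (β + 1) / (√x * (m * m)) * v ^ (-2:ℝ) := by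
    calc _ ≤ _ := KK_bound2 hx hs0
      _ ≤ 2 * (2 * x) ^ (β + 1) / (√x * ((m * v) * (m * v))) := by
        gcongr
        linarith
      _ = _ := by
        rw [Real.rpow_neg (by linarith), Real.rpow_two]; field_simp
  rw [norm_mul]
  calc _ ≤ (C * (√(1 + β) * v ^ (1/2:ℝ))) * (2 * (2 * x) ^ (β + 1) / (√x * (m * m)) * v ^ (-2:ℝ)) := by
        gcongr
        exact (hΦ s h1 h2).trans (by gcongr)
    _ = C * √(1 + β) * (2 * (2 * x) ^ (β + 1) / (√x * (m * m))) * (v ^ (1/2:ℝ) * v ^ (-2:ℝ)) := by ring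
    _ = _ := by rw [← Real.rpow_add (by linarith)]; norm_num

lemma PhiK_shift {x α β C : ℝ} (hx : 1 ≤ x) (hα : 0 < α) (hαβ : α ≤ β) (hC : 0 ≤ C) {Φ : ℂ → ℂ}
    (hd : ∀ s : ℂ, α ≤ s.re → s.re ≤ β → DifferentiableAt ℂ Φ s)
    (hΦ : ∀ s : ℂ, α ≤ s.re → s.re ≤ β → ‖Φ s‖ ≤ C * √(1 + ‖s‖)) :
    ∫ y : ℝ, Φ (α + y * I) * KK x (α + y * I) = ∫ y : ℝ, Φ (β + y * I) * KK x (β + y * I) := by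
  obtain ⟨M, hM⟩ := PhiK_decay hx hα hC hΦ
  exact contour_shift (G := fun s => Φ s * KK x s) hαβ
    (fun s h1 h2 => (hd s h1 h2).mul (KK_diff hx (by linarith))) hM

lemma PhiK_integrable {x c C : ℝ} (hx : 1 ≤ x) (hc : 0 < c) (hC : 0 ≤ C) {Φ : ℂ → ℂ}
    (hd : Continuous fun y : ℝ => Φ (c + y * I))
    (hΦ : ∀ s : ℂ, s.re = c → ‖Φ s‖ ≤ C * √(1 + ‖s‖)) :
    Integrable fun y : ℝ => Φ (c + y * I) * KK x (c + y * I) := by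
  obtain ⟨M, hM⟩ := PhiK_decay (β := c) hx hc hC (Φ := Φ) (fun s h1 h2 => hΦ s (le_antisymm h2 h1))
  have hKc : Continuous fun y : ℝ => KK x (c + y * I) := by
    rw [continuous_iff_continuousAt]
    intro y
    have : ContinuousAt (KK x) (c + y * I) := (KK_diff hx (by simpa using hc)).continuousAt
    exact ContinuousAt.comp (g := KK x) (f := fun y : ℝ => (c + y * I : ℂ)) this (by fun_prop)
  refine (integrable_decay.const_mul M).mono' (hd.mul hKc).aestronglyMeasurable (Eventually.of_forall fun y => ?_)
  have := hM (c + y * I) (by simp) (by simp)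
  simpa using this

noncomputable def ww (x : ℝ) (n : ℕ) : ℝ := (max (x + √x - n) 0 - max (x - n) 0) / √x

lemma KK_perron {x : ℝ} (hx : 1 ≤ x) {n : ℕ} (hn : 0 < n) :
    ∫ y : ℝ, (n:ℂ) ^ (-(2 + y * I : ℂ)) * KK x (2 + y * I) = 2 * Real.pi * (ww x n : ℝ) := by
  have hx0 : 0 < x := by linarith
  have hsx : 0 < √x := Real.sqrt_pos.mpr hx0
  have hn0 : (0:ℝ) < n := by exact_mod_cast hn
  have hgen : ∀ u : ℝ, 0 < u → (Integrable fun y : ℝ => (n:ℂ) ^ (-(2 + y * I : ℂ)) * (((u:ℂ) ^ (2 + y * I + 1 : ℂ)) / ((2 + y * I) * (2 + y * I + 1)))) ∧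
      ∫ y : ℝ, (n:ℂ) ^ (-(2 + y * I : ℂ)) * (((u:ℂ) ^ (2 + y * I + 1 : ℂ)) / ((2 + y * I) * (2 + y * I + 1))) = 2 * Real.pi * (max (u - n) 0 : ℝ) := by
    intro u hu
    have hu' : (u:ℂ) ≠ 0 := by rw [Complex.ofReal_ne_zero]; positivity
    have hp := perron (c := 2) (x := u / n) (by norm_num) (by positivity)
    have heq : ∀ y : ℝ, (n:ℂ) ^ (-(2 + y * I : ℂ)) * (((u:ℂ) ^ (2 + y * I + 1 : ℂ)) / ((2 + y * I) * (2 + y * I + 1))) =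
        u * (((u / n : ℝ) : ℂ) ^ (((2:ℝ):ℂ) + y * I : ℂ) / ((((2:ℝ):ℂ) + y * I) * (((2:ℝ):ℂ) + y * I + 1))) := by
      intro y
      rw [Complex.cpow_add _ _ hu', Complex.cpow_one, div_eq_mul_inv (u:ℝ) (n:ℝ), Complex.ofReal_mul,
        Complex.mul_cpow_ofReal_nonneg hu.le (by positivity), Complex.ofReal_inv, Complex.ofReal_natCast,
        Complex.inv_cpow _ _ (by rw [Complex.natCast_arg]; exact Real.pi_ne_zero.symm), Complex.cpow_neg]
      push_cast
      ring
    constructor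
    · simp_rw [heq]
      refine Integrable.const_mul ?_ _
      have hv := vert_integrable (c := 2) (by norm_num)
      refine (hv.norm.const_mul ((u / n) ^ (2:ℝ))).mono' ?_ (Eventually.of_forall fun y => ?_)
      · have hb : ((u / n : ℝ) : ℂ) ≠ 0 := by rw [Complex.ofReal_ne_zero]; positivity
        have h1 : Continuous fun y : ℝ => ((u / n : ℝ) : ℂ) ^ (((2:ℝ):ℂ) + y * I : ℂ) :=
          Continuous.const_cpow (by fun_prop) (Or.inl hb)
        have h2 := h1.aestronglyMeasurable (μ := volume) |>.mul hv.aestronglyMeasurable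
        refine h2.congr (Eventually.of_forall fun y => ?_)
        simp only [Pi.mul_apply]
        rw [mul_one_div]
      · rw [div_eq_mul_one_div, norm_mul, Complex.norm_cpow_eq_rpow_re_of_pos (by positivity)]
        simp
    · simp_rw [heq]
      rw [integral_const_mul, hp]
      have : u * max (1 - (u / n)⁻¹) 0 = max (u - n) 0 := by
        rw [mul_max_of_nonneg _ _ hu.le, mul_zero]
        congr 1; field_simp
      rw [← this]; push_cast; ring
  obtain ⟨i1, e1⟩ := hgen (x + √x) (by positivity)
  obtain ⟨i2, e2⟩ := hgen x hx0
  have hsx' : ((√x : ℝ) : ℂ) ≠ 0 := by rw [Complex.ofReal_ne_zero]; positivity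
  have : ∀ y : ℝ, (n:ℂ) ^ (-(2 + y * I : ℂ)) * KK x (2 + y * I) =
      (√x : ℂ)⁻¹ * ((n:ℂ) ^ (-(2 + y * I : ℂ)) * ((((x + √x : ℝ):ℂ) ^ (2 + y * I + 1 : ℂ)) / ((2 + y * I) * (2 + y * I + 1))) -
        (n:ℂ) ^ (-(2 + y * I : ℂ)) * (((x:ℂ) ^ (2 + y * I + 1 : ℂ)) / ((2 + y * I) * (2 + y * I + 1)))) := by
    intro y
    unfold KK
    rw [div_eq_mul_inv, div_eq_mul_inv, div_eq_mul_inv, mul_inv]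
    ring
  simp_rw [this]
  rw [integral_const_mul, integral_sub i1 i2, e1, e2]
  unfold ww
  push_cast
  field_simp
end GRHAux
end

section
open Complex MeasureTheory Filter Topology
namespace GRHAux
open DirichletCharacter ComplexConjugate
open ArithmeticFunction (vonMangoldt)

lemma one_le_sqrt_one_add (s : ℂ) : 1 ≤ √(1 + ‖s‖) := by
  rw [Real.one_le_sqrt]; linarith [norm_nonneg s]

lemma KK_sum {q : ℕ} [NeZero q] (χ : DirichletCharacter ℂ q) {x : ℝ} (hx : 1 ≤ x) (t : ℝ) :
    HasSum (fun n : ℕ => (vonMangoldt n : ℂ) * χ (n : ZMod q) * (n:ℂ) ^ (-(I * t)) * (2 * Real.pi * (ww x n : ℝ)))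
      (∫ y : ℝ, -logDeriv (LFunction χ) (2 + y * I + t * I) * KK x (2 + y * I)) := by
  have hK : Integrable fun y : ℝ => KK x (2 + y * I) := by
    have := PhiK_integrable (c := 2) (C := 1) hx (by norm_num) (by norm_num) (Φ := fun _ => 1) continuous_const
      (fun s _ => by simpa using one_le_sqrt_one_add s)
    simpa using this
  let F : ℕ → ℝ → ℂ := fun n y => (vonMangoldt n : ℂ) * χ (n : ZMod q) * (n:ℂ) ^ (-(2 + y * I + t * I : ℂ)) * KK x (2 + y * I)
  have hFb : ∀ n y, ‖F n y‖ ≤ vonMangoldt n * (n:ℝ) ^ (-2:ℝ) * ‖KK x (2 + y * I)‖ := by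
    intro n y
    simp only [F]
    rw [norm_mul]
    have := term_norm_le χ (2 + y * I + t * I) n
    simp only [add_re, re_ofNat, mul_re, ofReal_re, I_re, mul_zero, ofReal_im, I_im, mul_one, sub_self, add_zero] at this
    gcongr
  have hFi : ∀ n, Integrable (F n) := by
    intro n
    rcases Nat.eq_zero_or_pos n with rfl | hn
    · simp [F]
    · have hn' : (n:ℂ) ≠ 0 := by exact_mod_cast hn.ne'
      refine (hK.norm.const_mul (vonMangoldt n * (n:ℝ) ^ (-2:ℝ))).mono' ?_ (Eventually.of_forall (hFb n))
      refine AEStronglyMeasurable.mul ?_ hK.aestronglyMeasurable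
      apply Continuous.aestronglyMeasurable
      refine continuous_const.mul ?_
      exact Continuous.const_cpow (by fun_prop) (Or.inl hn')
  have hs : Summable fun n => ∫ y, ‖F n y‖ := by
    refine Summable.of_nonneg_of_le (fun n => integral_nonneg fun y => norm_nonneg _) (fun n => ?_)
      ((VV_summable (σ := 2) (by norm_num)).mul_right (∫ y : ℝ, ‖KK x (2 + y * I)‖))
    rw [← integral_const_mul]
    exact integral_mono (hFi n).norm (hK.norm.const_mul _) (hFb n)
  have := hasSum_integral_of_summable_integral_norm hFi hs
  have e1 : ∀ y : ℝ, ∑' n, F n y = -logDeriv (LFunction χ) (2 + y * I + t * I) * KK x (2 + y * I) := by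
    intro y
    exact ((logDeriv_hasSum χ (s := 2 + y * I + t * I) (by simp)).mul_right (KK x (2 + y * I))).tsum_eq
  simp_rw [e1] at this
  rw [show (fun n : ℕ => (vonMangoldt n : ℂ) * χ (n : ZMod q) * (n:ℂ) ^ (-(I * t)) * (2 * Real.pi * (ww x n : ℝ))) =
    fun n => ∫ y, F n y from ?_]
  · exact this
  funext n
  rcases Nat.eq_zero_or_pos n with rfl | hn
  · simp [F]
  · rw [← KK_perron hx hn, ← integral_const_mul]
    congr 1; ext y
    simp only [F]
    have hn' : (n:ℂ) ≠ 0 := by exact_mod_cast hn.ne'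
    rw [show -(2 + y * I + t * I : ℂ) = -(2 + y * I) + -(I * t) by ring, Complex.cpow_add _ _ hn']
    ring

theorem sum_le_integral {q : ℕ} [NeZero q] (χ : DirichletCharacter ℂ q) {x : ℝ} (hx : 2 ≤ x) (t : ℝ) :
    ‖∑ n ∈ Finset.Icc 1 ⌊x⌋₊, (vonMangoldt n : ℂ) * χ (n : ZMod q) * (n:ℂ) ^ (-(I * t))‖ ≤
      ‖∫ y : ℝ, -logDeriv (LFunction χ) (2 + y * I + t * I) * KK x (2 + y * I)‖ + 4 * √x * Real.log x := by
  have hx1 : 1 ≤ x := by linarith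
  have hsx : 1 ≤ √x := by rwa [Real.one_le_sqrt]
  have hsx' := sqrt_le_self' hx1
  set a : ℕ → ℂ := fun n => (vonMangoldt n : ℂ) * χ (n : ZMod q) * (n:ℂ) ^ (-(I * t)) with ha
  have hab : ∀ n, ‖a n‖ ≤ vonMangoldt n := by
    intro n
    have := term_norm_le χ (I * t) n
    simpa [ha] using this
  have hS := KK_sum χ hx1 t
  set T := ∫ y : ℝ, -logDeriv (LFunction χ) (2 + y * I + t * I) * KK x (2 + y * I)
  have hw1 : ∀ n : ℕ, n ≤ ⌊x⌋₊ → ww x n = 1 := by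
    intro n hn
    have : (n:ℝ) ≤ x := (Nat.le_floor_iff (by linarith)).mp hn
    unfold ww
    rw [max_eq_left (by linarith), max_eq_left (by linarith)]
    field_simp; ring
  have hw01 : ∀ n : ℕ, |ww x n| ≤ 1 := by
    intro n
    unfold ww
    rw [abs_div, abs_of_pos (show 0 < √x by linarith), div_le_one (by linarith)]
    have := abs_max_sub_max_le_abs (x + √x - n) (x - n) 0
    rw [show x + √x - n - (x - n) = √x by ring, abs_of_pos (show 0 < √x by linarith)] at this
    exact this
  set N := ⌊x + √x⌋₊ with hN
  have hw0 : ∀ n : ℕ, N < n → ww x n = 0 := by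
    intro n hn
    have : x + √x < n := Nat.lt_of_floor_lt hn
    unfold ww
    rw [max_eq_right (by linarith), max_eq_right (by linarith)]
    simp
  have hT : T = ∑ n ∈ Finset.Icc 1 N, a n * (2 * Real.pi * (ww x n : ℝ)) := by
    rw [← hS.tsum_eq]
    refine tsum_eq_sum fun n hn => ?_
    rw [Finset.mem_Icc, not_and_or] at hn
    rcases hn with hn | hn
    · have : n = 0 := by omega
      simp [this]
    · rw [hw0 n (by omega)]; simp
  have hMN : ⌊x⌋₊ ≤ N := Nat.floor_mono (by linarith)
  have hsplit : Finset.Icc 1 N = Finset.Icc 1 ⌊x⌋₊ ∪ Finset.Ioc ⌊x⌋₊ N := by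
    have h1 : 1 ≤ ⌊x⌋₊ := Nat.le_floor (by simpa using hx1)
    ext k; simp; omega
  have hdisj : Disjoint (Finset.Icc 1 ⌊x⌋₊) (Finset.Ioc ⌊x⌋₊ N) := by
    rw [Finset.disjoint_left]; intro k; simp; omega
  rw [hsplit, Finset.sum_union hdisj] at hT
  have hT1 : ∑ n ∈ Finset.Icc 1 ⌊x⌋₊, a n * (2 * Real.pi * (ww x n : ℝ)) = 2 * Real.pi * ∑ n ∈ Finset.Icc 1 ⌊x⌋₊, a n := by
    rw [Finset.mul_sum]
    refine Finset.sum_congr rfl fun n hn => ?_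
    rw [hw1 n (Finset.mem_Icc.mp hn).2]; push_cast; ring
  have hT2 : ∑ n ∈ Finset.Ioc ⌊x⌋₊ N, a n * (2 * Real.pi * (ww x n : ℝ)) = 2 * Real.pi * ∑ n ∈ Finset.Ioc ⌊x⌋₊ N, a n * (ww x n : ℝ) := by
    rw [Finset.mul_sum]
    refine Finset.sum_congr rfl fun n hn => ?_
    ring
  rw [hT1, hT2, ← mul_add] at hT
  have hb2 : ‖∑ n ∈ Finset.Ioc ⌊x⌋₊ N, a n * (ww x n : ℝ)‖ ≤ 4 * √x * Real.log x := by
    have hlog : 0 < Real.log x := Real.log_pos (by linarith)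
    have : ∀ n ∈ Finset.Ioc ⌊x⌋₊ N, ‖a n * (ww x n : ℝ)‖ ≤ 2 * Real.log x := by
      intro n hn
      rw [Finset.mem_Ioc] at hn
      have h1 : (n:ℝ) ≤ x + √x := (Nat.le_floor_iff (by positivity)).mp hn.2
      have h0 : (0:ℝ) < n := by exact_mod_cast (by omega : 0 < n)
      rw [norm_mul, Complex.norm_real, Real.norm_eq_abs]
      calc _ ≤ vonMangoldt n * 1 := by
            have := hab n; have := hw01 n
            gcongr
        _ ≤ Real.log n := by rw [mul_one]; exact ArithmeticFunction.vonMangoldt_le_log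
        _ ≤ Real.log (x ^ 2) := Real.log_le_log h0 (by nlinarith)
        _ = 2 * Real.log x := by rw [Real.log_pow]; norm_num
    refine (norm_sum_le_of_le _ this).trans ?_
    rw [Finset.sum_const, Nat.card_Ioc, nsmul_eq_mul, Nat.cast_sub hMN]
    have h1 : (N:ℝ) ≤ x + √x := Nat.floor_le (by positivity)
    have h2 : x < ⌊x⌋₊ + 1 := Nat.lt_floor_add_one x
    calc _ ≤ (2 * √x) * (2 * Real.log x) := by gcongr; linarith
      _ = _ := by ring
  have hpi := Real.pi_gt_three
  have hfin : ‖∑ n ∈ Finset.Icc 1 ⌊x⌋₊, a n + ∑ n ∈ Finset.Ioc ⌊x⌋₊ N, a n * (ww x n : ℝ)‖ ≤ ‖T‖ := by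
    rw [hT, norm_mul, norm_mul, Complex.norm_real, Real.norm_of_nonneg (by linarith)]
    simp only [Complex.norm_ofNat]
    refine le_mul_of_one_le_left (norm_nonneg _) (by linarith)
  calc ‖∑ n ∈ Finset.Icc 1 ⌊x⌋₊, a n‖ = ‖(∑ n ∈ Finset.Icc 1 ⌊x⌋₊, a n + ∑ n ∈ Finset.Ioc ⌊x⌋₊ N, a n * (ww x n : ℝ)) - ∑ n ∈ Finset.Ioc ⌊x⌋₊ N, a n * (ww x n : ℝ)‖ := by congr 1; ring
    _ ≤ _ := norm_sub_le _ _
    _ ≤ _ := by linarith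
end GRHAux
end

section
open Complex MeasureTheory Filter Topology
namespace GRHAux
open DirichletCharacter ComplexConjugate
open ArithmeticFunction (vonMangoldt)

noncomputable def JJ : ℝ := ∫ y : ℝ, (1 + |y|) ^ (-(3/2) : ℝ)

lemma logDeriv_conj {q : ℕ} [NeZero q] {χ : DirichletCharacter ℂ q} (hχ : χ ≠ 1) (s : ℂ) :
    logDeriv (LFunction χ⁻¹) (conj s) = conj (logDeriv (LFunction χ) s) := by
  have h1 : LFunction χ⁻¹ = conj ∘ LFunction χ ∘ conj := by
    ext s
    have := LFunction_conj hχ (conj s)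
    simpa using this
  rw [logDeriv_apply, logDeriv_apply, h1]
  have h2 := (differentiable_LFunction hχ s).hasDerivAt
  have h3 : HasDerivAt (conj ∘ LFunction χ ∘ conj) (conj (deriv (LFunction χ) s)) (conj s) := by
    have := HasDerivAt.conj_conj h2
    exact this
  rw [h3.deriv]
  simp

lemma KK_delta {x δ : ℝ} (hx : 1 ≤ x) (hδ : 0 < δ) (hδ1 : δ ≤ 1) (h2 : (2 * x) ^ δ ≤ 2) (y : ℝ) :
    ‖KK x (δ + y * I)‖ ≤ 12 * x ^ (1/4:ℝ) / δ * (1 + |y|) ^ (-(3/2):ℝ) := by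
  have hx0 : 0 < x := by linarith
  have hsx : 0 < √x := Real.sqrt_pos.mpr hx0
  set s : ℂ := δ + y * I with hs
  have hre : s.re = δ := by simp [hs]
  have him : s.im = y := by simp [hs]
  set v := 1 + |y| with hv
  have hv1 : 1 ≤ v := by linarith [abs_nonneg y]
  have n1 : δ / 2 * v ≤ ‖s‖ := by
    have := norm_lower (s := s) hδ (by rw [hre])
    rwa [min_eq_left hδ1, him] at this
  have n2 : 1 / 2 * v ≤ ‖s + 1‖ := by
    have := norm_lower (s := s + 1) one_pos (by simp [hre]; linarith)
    simpa [him] using this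
  have b1 := KK_bound1 hx (s := s) (by rw [hre]; exact hδ)
  have b2 := KK_bound2 hx (s := s) (by rw [hre]; exact hδ)
  rw [hre] at b1 b2
  have c1 : ‖KK x s‖ ≤ 2 / (δ / 2 * v) := b1.trans (by gcongr)
  have c2 : ‖KK x s‖ ≤ 2 * (2 * (2 * x)) / (√x * ((δ / 2 * v) * (1/2 * v))) := by
    refine b2.trans ?_
    rw [Real.rpow_add (by positivity), Real.rpow_one]
    gcongr
  have hxs : x = √x * √x := (Real.mul_self_sqrt hx0.le).symm
  have hsq : ‖KK x s‖ ^ 2 ≤ 128 * √x / (δ ^ 2 * v ^ 3) := by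
    calc ‖KK x s‖ ^ 2 = ‖KK x s‖ * ‖KK x s‖ := by ring
      _ ≤ 2 / (δ / 2 * v) * (2 * (2 * (2 * x)) / (√x * ((δ / 2 * v) * (1/2 * v)))) := by gcongr
      _ = _ := by
        rw [div_mul_div_comm, div_eq_div_iff (by positivity) (by positivity)]
        nth_rw 1 [hxs]
        ring
  refine le_of_sq_le_sq ?_ (by positivity) |> id
  refine hsq.trans ?_
  have e1 : (x ^ (1/4:ℝ)) ^ 2 = √x := by
    rw [← Real.rpow_natCast, ← Real.rpow_mul hx0.le, Real.sqrt_eq_rpow]; norm_num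
  have e2 : (v ^ (-(3/2):ℝ)) ^ 2 = (v ^ 3)⁻¹ := by
    rw [← Real.rpow_natCast, ← Real.rpow_mul (by linarith), ← Real.rpow_natCast, ← Real.rpow_neg (by linarith)]; norm_num
  rw [mul_pow, div_pow, mul_pow, e1, e2, ← div_eq_mul_inv, div_div]
  gcongr
  norm_num

theorem T_split (hG : GRH) {q : ℕ} [NeZero q] {χ : DirichletCharacter ℂ q} (hχ : χ ≠ 1) {x δ : ℝ} (hx : 1 ≤ x)
    (hδ : 0 < δ) (hδ1 : δ ≤ 1/2) (h2 : (2 * x) ^ δ ≤ 2) (t : ℝ) {σ : ℝ} (hσ : σ = 1/2 + δ) :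
    (Integrable fun y : ℝ => ((2 * (logDeriv (LFunction χ) (σ + (t + y : ℝ) * I)).re : ℝ) : ℂ) * KK x (σ + y * I)) ∧
    ‖∫ y : ℝ, -logDeriv (LFunction χ) (2 + y * I + t * I) * KK x (2 + y * I)‖ ≤
      ‖∫ y : ℝ, ((2 * (logDeriv (LFunction χ) (σ + (t + y : ℝ) * I)).re : ℝ) : ℂ) * KK x (σ + y * I)‖ +
        72 * JJ * x ^ (1/4:ℝ) / δ ^ 3 := by
  have hχ' : χ⁻¹ ≠ 1 := by simpa using hχ
  have hσ0 : 0 < σ := by linarith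
  have hld : ∀ (ψ : DirichletCharacter ℂ q), ψ ≠ 1 → ∀ s : ℂ, 1/2 < s.re → DifferentiableAt ℂ (logDeriv (LFunction ψ)) s := by
    intro ψ hψ s hs
    have h1 : Differentiable ℂ (deriv (LFunction ψ)) := (differentiable_LFunction hψ).deriv
    exact (h1 s).div (differentiable_LFunction hψ s) (L_ne_zero hG hψ hs)
  obtain ⟨C1, hC1, hg1⟩ := growth hG hχ hδ (by linarith)
  obtain ⟨C2, hC2, hg2⟩ := growth hG hχ' hδ (by linarith)
  -- first function
  let Φ1 : ℂ → ℂ := fun s => -logDeriv (LFunction χ) (s + t * I)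
  have hΦ1d : ∀ s : ℂ, σ ≤ s.re → DifferentiableAt ℂ Φ1 s := by
    intro s hs
    have := hld χ hχ (s + t * I) (by simp; linarith)
    exact (DifferentiableAt.comp (g := logDeriv (LFunction χ)) (f := fun s : ℂ => s + t * I) s this (by fun_prop)).neg
  have hsq : ∀ z s : ℂ, ∀ r : ℝ, 0 ≤ r → ‖z‖ ≤ r + ‖s‖ → √(1 + ‖z‖) ≤ √(1 + r) * √(1 + ‖s‖) := by
    intro z s r hr h
    rw [← Real.sqrt_mul (by positivity)]
    apply Real.sqrt_le_sqrt
    nlinarith [norm_nonneg s]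
  have hΦ1b : ∀ s : ℂ, σ ≤ s.re → ‖Φ1 s‖ ≤ C1 * √(1 + |t|) * √(1 + ‖s‖) := by
    intro s hs
    simp only [Φ1]
    rw [norm_neg, mul_assoc]
    refine ((hg1 (s + t * I) (by simp; linarith)).1).trans ?_
    gcongr
    refine hsq _ _ _ (abs_nonneg t) ?_
    calc _ ≤ ‖s‖ + ‖(t:ℂ) * I‖ := norm_add_le _ _
      _ = _ := by simp; ring
  have hshift1 := PhiK_shift (α := σ) (β := 2) hx hσ0 (by linarith) (by positivity) (fun s h _ => hΦ1d s h) (fun s h _ => hΦ1b s h)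
  let Φ2 : ℂ → ℂ := fun s => -logDeriv (LFunction χ⁻¹) (2 * σ - s - t * I)
  have hΦ2d : ∀ s : ℂ, s.re ≤ σ → DifferentiableAt ℂ Φ2 s := by
    intro s hs
    have := hld χ⁻¹ hχ' (2 * σ - s - t * I) (by simp; linarith)
    exact (DifferentiableAt.comp (g := logDeriv (LFunction χ⁻¹)) (f := fun s : ℂ => 2 * σ - s - t * I) s this (by fun_prop)).neg
  have hΦ2b : ∀ s : ℂ, s.re ≤ σ → ‖Φ2 s‖ ≤ C2 * √(1 + (2 * σ + |t|)) * √(1 + ‖s‖) := by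
    intro s hs
    simp only [Φ2]
    rw [norm_neg, mul_assoc]
    refine ((hg2 (2 * σ - s - t * I) (by simp; linarith)).1).trans ?_
    gcongr
    refine hsq _ _ _ (by positivity) ?_
    calc _ ≤ ‖(2 * σ - s : ℂ)‖ + ‖(t:ℂ) * I‖ := norm_sub_le _ _
      _ ≤ ‖(2 * σ : ℂ)‖ + ‖s‖ + ‖(t:ℂ) * I‖ := by gcongr; exact norm_sub_le _ _
      _ = _ := by simp [abs_of_pos hσ0]; ring
  have hshift2 := PhiK_shift (α := δ) (β := σ) hx hδ (by linarith) (by positivity) (fun s _ h => hΦ2d s h) (fun s _ h => hΦ2b s h)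
  have hc1 : Continuous fun y : ℝ => Φ1 (σ + y * I) := by
    rw [continuous_iff_continuousAt]
    intro y
    exact ContinuousAt.comp (g := Φ1) (f := fun y : ℝ => (σ + y * I : ℂ)) (hΦ1d _ (by simp)).continuousAt (by fun_prop)
  have hc2 : Continuous fun y : ℝ => Φ2 (σ + y * I) := by
    rw [continuous_iff_continuousAt]
    intro y
    exact ContinuousAt.comp (g := Φ2) (f := fun y : ℝ => (σ + y * I : ℂ)) (hΦ2d _ (by simp)).continuousAt (by fun_prop)
  have hi1 := PhiK_integrable (c := σ) hx hσ0 (by positivity) hc1 (fun s h => hΦ1b s h.ge)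
  have hi2 := PhiK_integrable (c := σ) hx hσ0 (by positivity) hc2 (fun s h => hΦ2b s h.le)
  have hrel : ∀ y : ℝ, ((2 * (logDeriv (LFunction χ) (σ + (t + y : ℝ) * I)).re : ℝ) : ℂ) * KK x (σ + y * I) =
      -(Φ1 (σ + y * I) * KK x (σ + y * I) + Φ2 (σ + y * I) * KK x (σ + y * I)) := by
    intro y
    simp only [Φ1, Φ2]
    have e1 : (σ + y * I + t * I : ℂ) = σ + (t + y : ℝ) * I := by push_cast; ring
    have e2 : (2 * σ - (σ + y * I) - t * I : ℂ) = conj (σ + (t + y : ℝ) * I : ℂ) := by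
      simp; ring
    rw [e1, e2, logDeriv_conj hχ, ← add_mul, ← neg_mul, ← neg_add, neg_neg, Complex.add_conj]
  refine ⟨?_, ?_⟩
  · simp_rw [hrel]
    exact (hi1.add hi2).neg
  · have h1 : ∫ y : ℝ, ((2 * (logDeriv (LFunction χ) (σ + (t + y : ℝ) * I)).re : ℝ) : ℂ) * KK x (σ + y * I) =
      -((∫ y : ℝ, Φ1 (σ + y * I) * KK x (σ + y * I)) + ∫ y : ℝ, Φ2 (σ + y * I) * KK x (σ + y * I)) := by
      simp_rw [hrel]
      rw [integral_neg, integral_add hi1 hi2]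
    have h3 : ∫ y : ℝ, -logDeriv (LFunction χ) (2 + y * I + t * I) * KK x (2 + y * I) =
        ∫ y : ℝ, Φ1 (σ + y * I) * KK x (σ + y * I) := by
      rw [hshift1]; simp [Φ1]
    rw [h1, h3, ← hshift2]
    have h4 : ‖∫ y : ℝ, Φ2 (δ + y * I) * KK x (δ + y * I)‖ ≤ 72 * JJ * x ^ (1/4:ℝ) / δ ^ 3 := by
      have : ∀ y : ℝ, ‖Φ2 (δ + y * I) * KK x (δ + y * I)‖ ≤ 6 / δ ^ 2 * (12 * x ^ (1/4:ℝ) / δ) * (1 + |y|) ^ (-(3/2):ℝ) := by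
        intro y
        rw [norm_mul, mul_assoc]
        gcongr
        · simp only [Φ2]
          rw [norm_neg]
          refine (logDeriv_le_VV χ⁻¹ (σ := 1 + δ) (by linarith) ?_).trans (VV_bound hδ (by linarith))
          simp [hσ]; linarith
        · exact KK_delta hx hδ (by linarith) h2 y
      refine (norm_integral_le_of_norm_le (integrable_decay.const_mul _) (Eventually.of_forall this)).trans ?_
      rw [integral_const_mul]
      apply le_of_eq
      unfold JJ
      field_simp
      ring
    rw [norm_neg]
    calc _ = ‖((∫ y : ℝ, Φ1 (σ + y * I) * KK x (σ + y * I)) + ∫ y : ℝ, Φ2 (δ + y * I) * KK x (δ + y * I)) - ∫ y : ℝ, Φ2 (δ + y * I) * KK x (δ + y * I)‖ := by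
          congr 1; ring
      _ ≤ _ := norm_sub_le _ _
      _ ≤ _ := by gcongr
end GRHAux
end

section
open Complex MeasureTheory Filter Topology
namespace GRHAux
open DirichletCharacter ComplexConjugate
open ArithmeticFunction (vonMangoldt)

lemma dyadic {a : ℝ} (ha : 1 ≤ a) {J : ℕ} (hJ : (2:ℝ) ^ J ≤ a) (hJ2 : a < 2 ^ (J + 1)) (d : ℕ → ℝ)
    (hd : ∀ j, (2:ℝ) ^ j ≤ d j) (hd2 : ∀ j, d j ≤ 2 ^ j + 2) (τ K : ℝ) (h0 : K ≤ 6 * a)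
    (h1 : K * |τ| ≤ 3 * a) (h2 : K * τ ^ 2 ≤ 12 * a ^ 2) :
    K ≤ 78 * a * ∑ j ∈ Finset.range (J + 1), d j / ((d j) ^ 2 + τ ^ 2) := by
  have key : ∃ j ∈ Finset.range (J + 1), K ≤ 78 * a * (d j / ((d j) ^ 2 + τ ^ 2)) := by
    have main : ∀ j, K * ((d j) ^ 2 + τ ^ 2) ≤ 78 * a * d j → K ≤ 78 * a * (d j / ((d j) ^ 2 + τ ^ 2)) := by
      intro j h
      have : 0 < d j := lt_of_lt_of_le (by positivity) (hd j)
      rw [← mul_div_assoc, le_div_iff₀ (by positivity)]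
      exact h
    have hsq : τ ^ 2 = |τ| ^ 2 := (sq_abs τ).symm
    rcases le_or_gt K 0 with hK | hK
    · refine ⟨0, by simp, main 0 ?_⟩
      have : 0 < d 0 := lt_of_lt_of_le (by positivity) (hd 0)
      have h3 : K * ((d 0) ^ 2 + τ ^ 2) ≤ 0 := mul_nonpos_of_nonpos_of_nonneg hK (by positivity)
      have : 0 ≤ 78 * a * d 0 := by positivity
      linarith
    rcases lt_or_ge |τ| 1 with hτ | hτ
    · refine ⟨0, by simp, main 0 ?_⟩
      have e1 := hd 0
      have e2 := hd2 0
      norm_num at e1 e2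
      have h3 : (d 0) ^ 2 + τ ^ 2 ≤ 13 * d 0 := by
        rw [hsq]; nlinarith [abs_nonneg τ]
      calc K * ((d 0) ^ 2 + τ ^ 2) ≤ 6 * a * (13 * d 0) := by gcongr
        _ = 78 * a * d 0 := by ring
    · obtain ⟨n, hn1, hn2⟩ := exists_nat_pow_near hτ (by norm_num : (1:ℝ) < 2)
      rcases le_or_gt n J with hnJ | hnJ
      · refine ⟨n, by simp; omega, main n ?_⟩
        have e1 := hd n
        have e2 := hd2 n
        have e0 : (1:ℝ) ≤ 2 ^ n := one_le_pow₀ (by norm_num)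
        rw [pow_succ] at hn2
        set D : ℝ := 2 ^ n
        have hKD : K * D ≤ 3 * a := (mul_le_mul_of_nonneg_left hn1 hK.le).trans h1
        have h3 : (d n) ^ 2 + τ ^ 2 ≤ 13 * D * d n := by
          rw [hsq]
          have a1 : |τ| ^ 2 ≤ 4 * D ^ 2 := by nlinarith [abs_nonneg τ]
          have a2 : (d n)^2 ≤ 3 * D * d n := by nlinarith
          nlinarith
        have hdp : 0 < d n := by linarith
        calc K * ((d n) ^ 2 + τ ^ 2) ≤ K * (13 * D * d n) := by gcongr
          _ = 13 * d n * (K * D) := by ring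
          _ ≤ 13 * d n * (3 * a) := by gcongr
          _ ≤ 78 * a * d n := by nlinarith [mul_pos hdp (by linarith : 0 < a)]
      · refine ⟨J, by simp, main J ?_⟩
        have e1 := hd J
        have e2 := hd2 J
        have e0 : (1:ℝ) ≤ 2 ^ J := one_le_pow₀ (by norm_num)
        have e3 : (2:ℝ) ^ (J + 1) ≤ |τ| := (pow_le_pow_right₀ (by norm_num) hnJ).trans hn1
        rw [pow_succ] at hJ2 e3
        set D : ℝ := 2 ^ J
        have h3 : (d J) ^ 2 + τ ^ 2 ≤ 13 / 4 * τ ^ 2 := by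
          rw [hsq]; nlinarith
        calc K * ((d J) ^ 2 + τ ^ 2) ≤ K * (13 / 4 * τ ^ 2) := by gcongr
          _ = 13 / 4 * (K * τ ^ 2) := by ring
          _ ≤ 13 / 4 * (12 * a ^ 2) := by gcongr
          _ ≤ 78 * a * d J := by nlinarith
  obtain ⟨j, hj, hK⟩ := key
  refine hK.trans ?_
  gcongr
  apply Finset.single_le_sum (f := fun j => d j / ((d j) ^ 2 + τ ^ 2)) _ hj
  intro i _
  have : 0 < d i := lt_of_lt_of_le (by positivity) (hd i)
  positivity

lemma KK_sum_bound {x δ σ : ℝ} (hx : 1 ≤ x) (hδ : 0 < δ) (h2 : (2 * x) ^ δ ≤ 2) (hσ : σ = 1/2 + δ)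
    {J : ℕ} (hJ : (2:ℝ) ^ J ≤ √x) (hJ2 : √x < 2 ^ (J + 1)) (d : ℕ → ℝ)
    (hd : ∀ j, (2:ℝ) ^ j ≤ d j) (hd2 : ∀ j, d j ≤ 2 ^ j + 2) (τ : ℝ) :
    ‖KK x (σ + τ * I)‖ ≤ 78 * √x * ∑ j ∈ Finset.range (J + 1), d j / ((d j) ^ 2 + τ ^ 2) := by
  have hx0 : 0 < x := by linarith
  have ha : 1 ≤ √x := by rw [Real.one_le_sqrt]; exact hx
  have ha2 : √x ^ 2 = x := Real.sq_sqrt hx0.le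
  have hre : ((σ:ℂ) + τ * I).re = σ := by simp
  have him : ((σ:ℂ) + τ * I).im = τ := by simp
  have hσ0 : 0 < σ := by linarith
  have hpow : (2 * x) ^ σ ≤ 3 * √x := by
    rw [hσ, Real.rpow_add (by positivity), ← Real.sqrt_eq_rpow, Real.sqrt_mul (by norm_num)]
    have : √2 ≤ 3/2 := by rw [Real.sqrt_le_left (by norm_num)]; norm_num
    calc √2 * √x * (2 * x) ^ δ ≤ 3/2 * √x * 2 := by gcongr
      _ = 3 * √x := by ring
  have b1 := KK_bound1 (s := σ + τ * I) hx (by rw [hre]; exact hσ0)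
  have b2 := KK_bound2 (s := σ + τ * I) hx (by rw [hre]; exact hσ0)
  rw [hre] at b1 b2
  have n1 : 1/2 ≤ ‖(σ + τ * I : ℂ)‖ := by
    have := Complex.abs_re_le_norm (σ + τ * I : ℂ)
    rw [hre, abs_of_pos hσ0] at this; linarith
  have n2 : |τ| ≤ ‖(σ + τ * I : ℂ)‖ := by
    have := Complex.abs_im_le_norm (σ + τ * I : ℂ)
    rwa [him] at this
  have n3 : |τ| ≤ ‖(σ + τ * I + 1 : ℂ)‖ := by
    have := Complex.abs_im_le_norm (σ + τ * I + 1 : ℂ)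
    simpa using this
  have n4 : 1 ≤ ‖(σ + τ * I + 1 : ℂ)‖ := by
    have := Complex.re_le_norm (σ + τ * I + 1 : ℂ)
    simp at this; linarith
  have np : 0 < ‖(σ + τ * I : ℂ)‖ := by linarith
  have hm : ‖KK x (σ + τ * I)‖ * ‖(σ + τ * I : ℂ)‖ ≤ 3 * √x := by
    rw [le_div_iff₀ np] at b1; linarith
  apply dyadic ha hJ hJ2 d hd hd2
  · nlinarith [norm_nonneg (KK x (σ + τ * I))]
  · exact (mul_le_mul_of_nonneg_left n2 (norm_nonneg _)).trans hm
  · rw [le_div_iff₀ (by positivity)] at b2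
    have e : (2 * x) ^ (σ + 1) ≤ 3 * √x * (2 * x) := by
      rw [Real.rpow_add_one (by positivity)]; gcongr
    have e2 : √x * (‖KK x (σ + τ * I)‖ * (‖(σ + τ * I : ℂ)‖ * ‖(σ + τ * I + 1 : ℂ)‖)) ≤ √x * (12 * x) := by
      calc _ = ‖KK x (σ + τ * I)‖ * (√x * (‖(σ + τ * I : ℂ)‖ * ‖(σ + τ * I + 1 : ℂ)‖)) := by ring
        _ ≤ 2 * (2 * x) ^ (σ + 1) := b2
        _ ≤ 2 * (3 * √x * (2 * x)) := by gcongr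
        _ = _ := by ring
    have e3 := le_of_mul_le_mul_left e2 (by linarith)
    rw [ha2]
    refine le_trans ?_ e3
    gcongr
    rw [← sq_abs, sq]
    gcongr

lemma main_int {q : ℕ} {χ : DirichletCharacter ℂ q} [NeZero q] {g : ℂ → ℂ}
    (hg : DifferentiableOn ℂ g {s | 1/2 < s.re})
    (hpos : ∀ s : ℂ, 1/2 < s.re → |(logDeriv (LFunction χ) s).re| ≤ (g s).re)
    {x δ σ : ℝ} (hx : 1 ≤ x) (hδ : 0 < δ) (h2 : (2 * x) ^ δ ≤ 2) (hσ : σ = 1/2 + δ)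
    {J : ℕ} (hJ : (2:ℝ) ^ J ≤ √x) (hJ2 : √x < 2 ^ (J + 1)) (d : ℕ → ℝ)
    (hd : ∀ j, (2:ℝ) ^ j ≤ d j) (hd2 : ∀ j, d j ≤ 2 ^ j + 2) (t : ℝ) {B : ℝ}
    (hB : ∀ j ∈ Finset.range (J + 1), (g (σ + d j + t * I)).re ≤ B)
    (hint : Integrable fun y : ℝ => ((2 * (logDeriv (LFunction χ) (σ + (t + y : ℝ) * I)).re : ℝ) : ℂ) * KK x (σ + y * I)) :
    ‖∫ y : ℝ, ((2 * (logDeriv (LFunction χ) (σ + (t + y : ℝ) * I)).re : ℝ) : ℂ) * KK x (σ + y * I)‖ ≤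
      156 * Real.pi * √x * ((J + 1) * B) := by
  have hpos' : ∀ s : ℂ, 1/2 < s.re → 0 ≤ (g s).re := fun s hs => (abs_nonneg _).trans (hpos s hs)
  have hT := intervalIntegral_tendsto_integral hint tendsto_neg_atTop_atBot tendsto_id
  refine le_of_tendsto hT.norm ?_
  filter_upwards [eventually_gt_atTop 0] with R hR
  simp only [id]
  have hgc : Continuous fun y : ℝ => (g (σ + (t + y : ℝ) * I)).re := by
    apply Complex.continuous_re.comp
    have : Continuous fun y : ℝ => (σ + (t + y : ℝ) * I : ℂ) := by fun_prop
    refine hg.continuousOn.comp_continuous this ?_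
    intro y; simp; linarith
  have hdp : ∀ j, 0 < d j := fun j => lt_of_lt_of_le (by positivity) (hd j)
  have hjc : ∀ j, Continuous fun y : ℝ => (g (σ + (t + y : ℝ) * I)).re * (d j / (d j ^ 2 + y ^ 2)) := by
    intro j
    refine hgc.mul (Continuous.div continuous_const (by fun_prop) ?_)
    intro y
    have := hdp j
    positivity
  have hbd : ∀ y : ℝ, ‖((2 * (logDeriv (LFunction χ) (σ + (t + y : ℝ) * I)).re : ℝ) : ℂ) * KK x (σ + y * I)‖ ≤
      156 * √x * ∑ j ∈ Finset.range (J + 1), (g (σ + (t + y : ℝ) * I)).re * (d j / (d j ^ 2 + y ^ 2)) := by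
    intro y
    have hs : 1/2 < (σ + (t + y : ℝ) * I : ℂ).re := by simp; linarith
    rw [norm_mul, Complex.norm_real, Real.norm_eq_abs, abs_mul, abs_two, ← Finset.mul_sum]
    have := KK_sum_bound hx hδ h2 hσ hJ hJ2 d hd hd2 y
    calc _ ≤ 2 * (g (σ + (t + y : ℝ) * I)).re * (78 * √x * ∑ j ∈ Finset.range (J + 1), d j / ((d j) ^ 2 + y ^ 2)) := by
          have := hpos _ hs
          have := hpos' _ hs
          gcongr
      _ = _ := by ring
  refine (intervalIntegral.norm_integral_le_of_norm_le (by linarith) (Eventually.of_forall fun y _ => hbd y) ?_).trans ?_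
  · apply Continuous.intervalIntegrable
    exact continuous_const.mul (continuous_finsetSum _ fun j _ => hjc j)
  rw [intervalIntegral.integral_const_mul, intervalIntegral.integral_finsetSum fun j _ => (hjc j).intervalIntegrable _ _]
  have : ∑ j ∈ Finset.range (J + 1), ∫ y in (-R)..R, (g (σ + (t + y : ℝ) * I)).re * (d j / (d j ^ 2 + y ^ 2)) ≤
      ∑ j ∈ Finset.range (J + 1), Real.pi * B := by
    apply Finset.sum_le_sum
    intro j hj
    refine (poisson_half_plane hg hpos' t (by linarith) (hdp j) hR).trans ?_
    exact mul_le_mul_of_nonneg_left (hB j hj) Real.pi_pos.le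
  calc _ ≤ 156 * √x * ∑ j ∈ Finset.range (J + 1), Real.pi * B := by gcongr
    _ = _ := by simp; ring

end GRHAux
end

open Complex MeasureTheory Filter Topology

theorem vonMangoldt_char_sum_GRH (hGRH : GRH) :
    ∃ C > 0, ∀ (q : ℕ) (_ : NeZero q) (χ : DirichletCharacter ℂ q), 1 < q →
      χ.IsPrimitive → ∀ u : ℝ, 1 ≤ u → ∀ t : ℝ,
      ‖∑ n ∈ Finset.Icc 1 ⌊u⌋₊, (ArithmeticFunction.vonMangoldt n : ℂ) * χ (n : ZMod q) * (n : ℂ) ^ (-(I * t))‖ ≤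
        C * Real.sqrt u * Real.log u * Real.log (q * u * (|t| + 2)) := by
  obtain ⟨C0, hC0, hmaj⟩ := GRHAux.majorant hGRH
  have hJJ : 0 ≤ GRHAux.JJ := by
    unfold GRHAux.JJ
    exact integral_nonneg fun y => by positivity
  refine ⟨468 * Real.pi * C0 + 294912 * GRHAux.JJ + 4, by positivity, ?_⟩
  intro q hq0 χ hq hprim u hu t
  have hqR : (2:ℝ) ≤ q := by exact_mod_cast hq
  have ht := abs_nonneg t
  rcases lt_or_ge u 2 with hu2 | hu2
  · have hfl : ⌊u⌋₊ = 1 := by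
      rw [Nat.floor_eq_iff (by linarith)]; norm_num; exact ⟨hu, by linarith⟩
    rw [hfl]
    simp only [Finset.Icc_self, Finset.sum_singleton, ArithmeticFunction.vonMangoldt_apply_one]
    simp only [ofReal_zero, zero_mul, norm_zero]
    have h1 : 0 ≤ Real.log u := Real.log_nonneg hu
    have h2 : 0 ≤ Real.log (q * u * (|t| + 2)) := by
      apply Real.log_nonneg
      have : 1 ≤ (q:ℝ) * u := by nlinarith
      nlinarith
    positivity
  have hχ : χ ≠ 1 := by
    rintro rfl
    have h : (1 : DirichletCharacter ℂ q).conductor = q := hprim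
    rw [DirichletCharacter.conductor_one] at h
    omega
  obtain ⟨g, hg, hpos, hgb⟩ := hmaj q hq0 χ hq hprim hχ
  set ℓ := Real.log u with hℓ
  set L := Real.log (q * u * (|t| + 2)) with hL
  have hl2 := Real.log_two_gt_d9
  have hℓ2 : Real.log 2 ≤ ℓ := Real.log_le_log (by norm_num) hu2
  have hℓ0 : 0 < ℓ := by linarith
  have hL1 : 1 ≤ L := by
    have : Real.log (2 * 2) ≤ L := by
      apply Real.log_le_log (by norm_num)
      have : 2 * 2 ≤ (q:ℝ) * u := by nlinarith
      nlinarith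
    rw [Real.log_mul (by norm_num) (by norm_num)] at this
    linarith
  have hu0 : 0 < u := by linarith
  set δ : ℝ := 1 / (4 * ℓ) with hδdef
  have hδ : 0 < δ := by positivity
  have hδℓ : δ * ℓ = 1/4 := by rw [hδdef]; field_simp
  have hδ1 : δ ≤ 1/2 := by
    by_contra hcon
    push Not at hcon
    nlinarith
  have h2 : (2 * u) ^ δ ≤ 2 := by
    rw [Real.rpow_def_of_pos (by positivity), Real.log_mul (by norm_num) (by positivity)]
    have e : (Real.log 2 + Real.log u) * δ ≤ 1/2 := by
      have : Real.log 2 * δ ≤ ℓ * δ := by gcongr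
      rw [← hℓ]; nlinarith
    have e2 : Real.exp (1/2) ≤ 2 := by
      rw [← Real.le_log_iff_exp_le (by norm_num)]; linarith
    exact (Real.exp_le_exp.mpr e).trans e2
  obtain ⟨hint, hT⟩ := GRHAux.T_split hGRH hχ hu hδ hδ1 h2 t (σ := 1/2 + δ) rfl
  have hsq1 : 1 ≤ √u := by rw [Real.one_le_sqrt]; exact hu
  obtain ⟨J, hJ, hJ2⟩ := exists_nat_pow_near hsq1 (by norm_num : (1:ℝ) < 2)
  have hch : ∀ j : ℕ, ∃ d : ℝ, (2:ℝ) ^ j ≤ d ∧ d ≤ 2 ^ j + 2 ∧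
      (g ((1/2 + δ : ℝ) + d + t * I)).re ≤ C0 * Real.log (q * (2 ^ j + |t| + 2)) := fun j =>
    hgb (2 ^ j) (one_le_pow₀ (by norm_num)) t (1/2 + δ) (by linarith) (by linarith)
  choose d hd hd2 hd3 using hch
  have hB : ∀ j ∈ Finset.range (J + 1), (g ((1/2 + δ : ℝ) + d j + t * I)).re ≤ C0 * L := by
    intro j hj
    refine (hd3 j).trans ?_
    have hjJ : (2:ℝ) ^ j ≤ u := by
      have : j ≤ J := by simpa [Nat.lt_succ_iff] using hj
      exact ((pow_le_pow_right₀ (by norm_num) this).trans hJ).trans (GRHAux.sqrt_le_self' hu)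
    have hle : (q:ℝ) * (2 ^ j + |t| + 2) ≤ q * u * (|t| + 2) := by
      rw [mul_assoc]
      gcongr
      nlinarith
    gcongr
    exact Real.log_le_log (by positivity) hle
  have hmain := GRHAux.main_int hg hpos hu hδ h2 rfl hJ hJ2 d hd hd2 t hB hint
  have hsum := GRHAux.sum_le_integral χ hu2 t
  have hJ1 : (J:ℝ) + 1 ≤ 3 * ℓ := by
    have : Real.log (2 ^ J) ≤ Real.log (√u) := Real.log_le_log (by positivity) hJ
    rw [Real.log_pow, Real.log_sqrt hu0.le, ← hℓ] at this
    have hJ0 : (0:ℝ) ≤ J := by positivity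
    nlinarith
  have herr : 72 * GRHAux.JJ * u ^ (1/4:ℝ) / δ ^ 3 ≤ 294912 * GRHAux.JJ * √u * ℓ := by
    have e1 : ℓ ≤ 8 * u ^ (1/8:ℝ) := by
      have := Real.log_le_rpow_div hu0.le (by norm_num : (0:ℝ) < 1/8)
      rw [← hℓ] at this
      linarith
    have e2 : u ^ (1/8:ℝ) * u ^ (1/8:ℝ) = u ^ (1/4:ℝ) := by
      rw [← Real.rpow_add hu0]; norm_num
    have e3 : u ^ (1/4:ℝ) * u ^ (1/4:ℝ) = √u := by
      rw [← Real.rpow_add hu0, Real.sqrt_eq_rpow]; norm_num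
    have e4 : ℓ * ℓ ≤ 64 * u ^ (1/4:ℝ) := by
      calc ℓ * ℓ ≤ (8 * u ^ (1/8:ℝ)) * (8 * u ^ (1/8:ℝ)) := by gcongr
        _ = 64 * u ^ (1/4:ℝ) := by rw [← e2]; ring
    calc 72 * GRHAux.JJ * u ^ (1/4:ℝ) / δ ^ 3 = 4608 * GRHAux.JJ * u ^ (1/4:ℝ) * ℓ * (ℓ * ℓ) := by
          rw [hδdef]; field_simp; ring
      _ ≤ 4608 * GRHAux.JJ * u ^ (1/4:ℝ) * ℓ * (64 * u ^ (1/4:ℝ)) := by gcongr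
      _ = 294912 * GRHAux.JJ * √u * ℓ := by rw [← e3]; ring
  have hpi := Real.pi_pos
  have hm2 : 156 * Real.pi * √u * ((J + 1) * (C0 * L)) ≤ 468 * Real.pi * C0 * √u * ℓ * L := by
    calc 156 * Real.pi * √u * ((J + 1) * (C0 * L)) ≤ 156 * Real.pi * √u * ((3 * ℓ) * (C0 * L)) := by gcongr
      _ = _ := by ring
  have hlow : (294912 * GRHAux.JJ + 4) * √u * ℓ ≤ (294912 * GRHAux.JJ + 4) * √u * ℓ * L :=
    le_mul_of_one_le_right (by positivity) hL1
  calc _ ≤ _ := hsum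
    _ ≤ 156 * Real.pi * √u * ((J + 1) * (C0 * L)) + 72 * GRHAux.JJ * u ^ (1/4:ℝ) / δ ^ 3 + 4 * √u * ℓ := by
        linarith
    _ ≤ 468 * Real.pi * C0 * √u * ℓ * L + 294912 * GRHAux.JJ * √u * ℓ + 4 * √u * ℓ := by linarith
    _ ≤ _ := by linarith
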